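/- For every integer k ≥ 0 and every signed permutation matrix χ, the block matrices [[0,0,0,0,α_k],[0,0,0,χ,0],[0,0,1,0,0],[0,χᵗ,0,0,0],[α_k,0,0,0,0]] and [[0,0,0,0,β_k],[0,0,0,χ,0],[0,0,1,0,0],[0,χᵗ,0,0,0],[β_k,0,0,0,0]] (with a single entry 1 in the central block) are I-Wilf equivalent: for every n ≥ 1 the number of signed involutions in SI_n avoiding the first pattern equals the number avoiding the second. -/

import Mathlib

open Matrix

/-- A signed permutation matrix: entries in {0,1,-1}, with exactly one nonzero
entry in each row and each column. -/
def IsSignedPermMatrix {n : ℕ} (M : Matrix (Fin n) (Fin n) ℤ) : Prop :=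
  (∀ i j, M i j = 0 ∨ M i j = 1 ∨ M i j = -1) ∧
  (∀ i, ∃! j, M i j ≠ 0) ∧
  (∀ j, ∃! i, M i j ≠ 0)

/-- `M` contains the pattern `τ`: some `k×k` submatrix of `M`, taken with rows
and columns in increasing order, equals `τ`. -/
def ContainsPattern {n k : ℕ} (M : Matrix (Fin n) (Fin n) ℤ)
    (τ : Matrix (Fin k) (Fin k) ℤ) : Prop :=
  ∃ r c : Fin k → Fin n, StrictMono r ∧ StrictMono c ∧
    ∀ a b, M (r a) (c b) = τ a b

/-- Block diagonal matrix [[A,0],[0,B]]. -/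
def blockDiag2 {a b : ℕ} (A : Matrix (Fin a) (Fin a) ℤ) (B : Matrix (Fin b) (Fin b) ℤ) :
    Matrix (Fin (a + b)) (Fin (a + b)) ℤ :=
  Matrix.reindex finSumFinEquiv finSumFinEquiv
    (Matrix.fromBlocks A (0 : Matrix (Fin a) (Fin b) ℤ) (0 : Matrix (Fin b) (Fin a) ℤ) B)

/-- Block diagonal matrix with three blocks. -/
def blockDiag3 {a b c : ℕ} (A : Matrix (Fin a) (Fin a) ℤ) (B : Matrix (Fin b) (Fin b) ℤ)
    (C : Matrix (Fin c) (Fin c) ℤ) : Matrix (Fin (a + b + c)) (Fin (a + b + c)) ℤ :=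
  blockDiag2 (blockDiag2 A B) C

/-- Block antidiagonal matrix [[0,A],[B,0]]. -/
def antiBlock2 {a b : ℕ} (A : Matrix (Fin a) (Fin a) ℤ) (B : Matrix (Fin b) (Fin b) ℤ) :
    Matrix (Fin (a + b)) (Fin (a + b)) ℤ :=
  Matrix.reindex finSumFinEquiv (finSumFinEquiv.trans (finCongr (Nat.add_comm b a)))
    (Matrix.fromBlocks (0 : Matrix (Fin a) (Fin b) ℤ) A B (0 : Matrix (Fin b) (Fin a) ℤ))

/-- For a signed permutation matrix σ, the involution σ' = [[0,σ],[σᵗ,0]]. -/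
def primePat {k : ℕ} (σ : Matrix (Fin k) (Fin k) ℤ) :
    Matrix (Fin (k + k)) (Fin (k + k)) ℤ :=
  Matrix.reindex finSumFinEquiv finSumFinEquiv
    (Matrix.fromBlocks (0 : Matrix (Fin k) (Fin k) ℤ) σ σ.transpose
      (0 : Matrix (Fin k) (Fin k) ℤ))

/-- For a signed permutation matrix σ, the involution σ'' = [[0,0,σ],[0,1,0],[σᵗ,0,0]]. -/
def doublePrimePat {k : ℕ} (σ : Matrix (Fin k) (Fin k) ℤ) :
    Matrix (Fin (k + (1 + k))) (Fin (k + (1 + k))) ℤ :=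
  Matrix.reindex ((Equiv.sumCongr (Equiv.refl (Fin k)) finSumFinEquiv).trans finSumFinEquiv)
    ((Equiv.sumCongr (Equiv.refl (Fin k)) finSumFinEquiv).trans finSumFinEquiv)
    (Matrix.fromBlocks
      (0 : Matrix (Fin k) (Fin k) ℤ)
      (Matrix.of fun (i : Fin k) (j : Fin 1 ⊕ Fin k) =>
        Sum.elim (fun _ => (0 : ℤ)) (fun j' => σ i j') j)
      (Matrix.of fun (i : Fin 1 ⊕ Fin k) (j : Fin k) =>
        Sum.elim (fun _ => (0 : ℤ)) (fun i' => σ.transpose i' j) i)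
      (Matrix.fromBlocks (1 : Matrix (Fin 1) (Fin 1) ℤ) 0 0 (0 : Matrix (Fin k) (Fin k) ℤ)))

/-- β_k, the antidiagonal k×k permutation matrix (pattern k(k-1)…1). -/
def betaMat (k : ℕ) : Matrix (Fin k) (Fin k) ℤ :=
  Matrix.of fun i j => if (i : ℕ) + (j : ℕ) + 1 = k then 1 else 0

/-- |SI_n(τ)|: the number of τ-avoiding signed involutions of size n. -/
noncomputable def SIAvoidCount (n : ℕ) {k : ℕ} (τ : Matrix (Fin k) (Fin k) ℤ) : ℕ :=
  {M : Matrix (Fin n) (Fin n) ℤ |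
    IsSignedPermMatrix M ∧ M.IsSymm ∧ ¬ ContainsPattern M τ}.ncard

/-- |B_n(τ)|: the number of τ-avoiding signed permutations of size n. -/
noncomputable def BAvoidCount (n : ℕ) {k : ℕ} (τ : Matrix (Fin k) (Fin k) ℤ) : ℕ :=
  {M : Matrix (Fin n) (Fin n) ℤ | IsSignedPermMatrix M ∧ ¬ ContainsPattern M τ}.ncard

/-- Length of the longest chain (increasing in both coordinates) of `x` inside
`[0, i) × [0, j)`, for `x` with at most one cell in each row and column. -/
noncomputable def chainLen (x : ℕ → ℕ → Prop) : ℕ → ℕ → ℕ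
  | 0, _ => 0
  | _ + 1, 0 => 0
  | i + 1, j + 1 =>
    open Classical in
    if x i j then chainLen x i j + 1 else max (chainLen x (i + 1) j) (chainLen x i (j + 1))

/-- At most one cell in each row and each column. -/
def PartialPerm (x : ℕ → ℕ → Prop) : Prop :=
  (∀ i j j', x i j → x i j' → j = j') ∧ ∀ i i' j, x i j → x i' j → i = i'

/-- The cells where a horizontal and a vertical shadow line of `x` meet (Viennot's skeleton). -/
def skel (x : ℕ → ℕ → Prop) (i j : ℕ) : Prop :=
  chainLen x (i + 1) j ≠ chainLen x i j ∧ chainLen x i (j + 1) ≠ chainLen x i j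

/-- The partition attached to the vertex `(i, j)` in the growth diagram of `x`. -/
noncomputable def shape (x : ℕ → ℕ → Prop) (i j : ℕ) : ℕ → ℕ :=
  fun t => chainLen (skel^[t] x) i j

section chainLen

variable {x y : ℕ → ℕ → Prop}

@[simp] lemma chainLen_zero_left (x : ℕ → ℕ → Prop) (j : ℕ) : chainLen x 0 j = 0 := by
  simp [chainLen]

@[simp] lemma chainLen_zero_right (x : ℕ → ℕ → Prop) (i : ℕ) : chainLen x i 0 = 0 := by
  cases i <;> simp [chainLen]

lemma chainLen_of_mem {i j : ℕ} (h : x i j) :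
    chainLen x (i + 1) (j + 1) = chainLen x i j + 1 := by
  rw [chainLen, if_pos h]

lemma chainLen_of_notMem {i j : ℕ} (h : ¬ x i j) :
    chainLen x (i + 1) (j + 1) = max (chainLen x (i + 1) j) (chainLen x i (j + 1)) := by
  rw [chainLen, if_neg h]

lemma chainLen_steps (x : ℕ → ℕ → Prop) (i j : ℕ) :
    (chainLen x i j ≤ chainLen x (i + 1) j ∧ chainLen x (i + 1) j ≤ chainLen x i j + 1) ∧
    (chainLen x i j ≤ chainLen x i (j + 1) ∧ chainLen x i (j + 1) ≤ chainLen x i j + 1) := by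
  have down : ∀ i j, (chainLen x i j ≤ chainLen x (i + 1) j ∧
        chainLen x (i + 1) j ≤ chainLen x i j + 1) ∧
      (chainLen x i j ≤ chainLen x i (j + 1) ∧ chainLen x i (j + 1) ≤ chainLen x i j + 1) →
      (chainLen x i (j + 1) ≤ chainLen x (i + 1) (j + 1) ∧
        chainLen x (i + 1) (j + 1) ≤ chainLen x i (j + 1) + 1) ∧
      (chainLen x (i + 1) j ≤ chainLen x (i + 1) (j + 1) ∧
        chainLen x (i + 1) (j + 1) ≤ chainLen x (i + 1) j + 1) := by
    intro i j h
    by_cases hx : x i j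
    · rw [chainLen_of_mem hx]; omega
    · rw [chainLen_of_notMem hx]; omega
  induction i generalizing j with
  | zero =>
    induction j with
    | zero => simp
    | succ j ih => exact ⟨(down 0 j ih).1, by simp⟩
  | succ i ihi =>
    induction j with
    | zero => exact ⟨by simp, (down i 0 (ihi 0)).2⟩
    | succ j ih => exact ⟨(down (i + 1) j ih).1, (down i (j + 1) (ihi (j + 1))).2⟩

lemma chainLen_mono (x : ℕ → ℕ → Prop) {i i' j j' : ℕ} (hi : i ≤ i') (hj : j ≤ j') :
    chainLen x i j ≤ chainLen x i' j' :=
  (monotone_nat_of_le_succ (f := fun i => chainLen x i j)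
      (fun i => (chainLen_steps x i j).1.1) hi).trans
    (monotone_nat_of_le_succ (f := fun j => chainLen x i' j)
      (fun j => (chainLen_steps x i' j).2.1) hj)

lemma chainLen_flip (x : ℕ → ℕ → Prop) (i j : ℕ) : chainLen (flip x) i j = chainLen x j i := by
  induction i generalizing j with
  | zero => simp
  | succ i ihi =>
    induction j with
    | zero => simp
    | succ j ihj =>
      by_cases hx : x j i
      · rw [chainLen_of_mem (x := flip x) hx, chainLen_of_mem hx, ihi]
      · rw [chainLen_of_notMem (x := flip x) hx, chainLen_of_notMem hx, ihi, ihj, max_comm]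

lemma skel_flip (x : ℕ → ℕ → Prop) : skel (flip x) = flip (skel x) := by
  ext i j
  simp only [skel, chainLen_flip, flip]
  tauto

lemma shape_flip (x : ℕ → ℕ → Prop) (i j : ℕ) : shape (flip x) i j = shape x j i := by
  have h : ∀ t, skel^[t] (flip x) = flip (skel^[t] x) := by
    intro t
    induction t generalizing x with
    | zero => rfl
    | succ t ih => rw [Function.iterate_succ_apply, Function.iterate_succ_apply, skel_flip, ih]
  funext t
  rw [shape, h, chainLen_flip, shape]

lemma PartialPerm.transpose (h : PartialPerm x) : PartialPerm (flip x) :=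
  ⟨fun i j j' => h.2 j j' i, fun i i' j => h.1 j i i'⟩

lemma chainLen_congr {i j : ℕ} (h : ∀ i' < i, ∀ j' < j, (x i' j' ↔ y i' j')) :
    chainLen x i j = chainLen y i j := by
  induction i generalizing j with
  | zero => simp
  | succ i ihi =>
    induction j with
    | zero => simp
    | succ j ihj =>
      have h1 := ihi (j := j) fun i' hi' j' hj' => h i' (by omega) j' (by omega)
      have h2 := ihi (j := j + 1) fun i' hi' j' hj' => h i' (by omega) j' (by omega)
      have h3 := ihj fun i' hi' j' hj' => h i' (by omega) j' (by omega)
      have h4 := h i (by omega) j (by omega)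
      by_cases hx : x i j
      · rw [chainLen_of_mem hx, chainLen_of_mem (h4.1 hx), h1]
      · rw [chainLen_of_notMem hx, chainLen_of_notMem (mt h4.2 hx), h2, h3]

lemma shape_congr {i j : ℕ} (h : ∀ i' < i, ∀ j' < j, (x i' j' ↔ y i' j')) :
    shape x i j = shape y i j := by
  have key : ∀ t, ∀ i' < i, ∀ j' < j, (skel^[t] x i' j' ↔ skel^[t] y i' j') := by
    intro t
    induction t with
    | zero => exact h
    | succ t ih =>
      intro i' hi' j' hj'
      rw [Function.iterate_succ_apply', Function.iterate_succ_apply']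
      rw [skel, skel, chainLen_congr (i := i' + 1) (j := j') fun a ha b hb => ih a (by omega) b (by omega),
        chainLen_congr (i := i') (j := j' + 1) fun a ha b hb => ih a (by omega) b (by omega),
        chainLen_congr (i := i') (j := j') fun a ha b hb => ih a (by omega) b (by omega)]
  funext t
  exact chainLen_congr (key t)

lemma chainLen_succ_left_of_row_empty {i j : ℕ} (h : ∀ j' < j, ¬ x i j') :
    chainLen x (i + 1) j = chainLen x i j := by
  induction j with
  | zero => simp
  | succ j ih =>
    have := ih fun j' hj' => h j' (by omega)
    rw [chainLen_of_notMem (h j (by omega)), this]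
    exact max_eq_right (chainLen_steps x i j).2.1

lemma chainLen_pos_iff {i j : ℕ} : 0 < chainLen x i j ↔ ∃ i' < i, ∃ j' < j, x i' j' := by
  constructor
  · intro h
    by_contra! hn
    have : chainLen x i j = 0 := by
      clear h
      induction i with
      | zero => simp
      | succ i ih =>
        rw [chainLen_succ_left_of_row_empty (hn i (by omega))]
        exact ih fun i' hi' => hn i' (by omega)
    omega
  · rintro ⟨i', hi', j', hj', hx⟩
    have h1 := chainLen_mono x (show i' + 1 ≤ i from hi') (show j' + 1 ≤ j from hj')
    rw [chainLen_of_mem hx] at h1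
    omega

end chainLen

namespace PartialPerm

variable {x y : ℕ → ℕ → Prop}

lemma row_eq (hp : PartialPerm x) {i j : ℕ} (hx : x i j) :
    chainLen x (i + 1) j = chainLen x i j := by
  refine chainLen_succ_left_of_row_empty fun j' hj' hx' => ?_
  have := hp.1 _ _ _ hx hx'
  omega

lemma col_eq (hp : PartialPerm x) {i j : ℕ} (hx : x i j) :
    chainLen x i (j + 1) = chainLen x i j := by
  have := hp.transpose.row_eq (i := j) (j := i) hx
  rwa [chainLen_flip, chainLen_flip] at this

lemma mem_iff (hp : PartialPerm x) (i j : ℕ) :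
    x i j ↔ max (chainLen x (i + 1) j) (chainLen x i (j + 1)) < chainLen x (i + 1) (j + 1) := by
  by_cases hx : x i j
  · rw [chainLen_of_mem hx, hp.row_eq hx, hp.col_eq hx]; simp [hx]
  · rw [chainLen_of_notMem hx]; simp [hx]

lemma row_line_succ (hp : PartialPerm x) (i j : ℕ) :
    chainLen x (i + 1) (j + 1) ≠ chainLen x i (j + 1) ↔
      x i j ∨ (chainLen x (i + 1) j ≠ chainLen x i j ∧ ¬ skel x i j) := by
  have h := chainLen_steps x i j
  by_cases hx : x i j
  · rw [chainLen_of_mem hx, hp.col_eq hx]; simp [hx]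
  · rw [chainLen_of_notMem hx]
    simp only [hx, skel, false_or]
    omega

/-- A horizontal line at `(i, j)` starts at a cell of `x` and has met no vertical line since. -/
lemma exists_of_row_line (hp : PartialPerm x) {i j : ℕ}
    (h : chainLen x (i + 1) j ≠ chainLen x i j) :
    ∃ j₀ < j, x i j₀ ∧ ∀ j' < j, ¬ skel x i j' := by
  induction j with
  | zero => simp at h
  | succ j ih =>
    rcases (hp.row_line_succ i j).1 h with hx | ⟨h1, h2⟩
    · refine ⟨j, by omega, hx, fun j' hj' hs => hs.1 ?_⟩
      refine chainLen_succ_left_of_row_empty fun j'' hj'' hx' => ?_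
      have := hp.1 _ _ _ hx hx'
      omega
    · obtain ⟨j₀, hj₀, hx, hn⟩ := ih h1
      refine ⟨j₀, by omega, hx, fun j' hj' => ?_⟩
      rcases Nat.lt_succ_iff_lt_or_eq.1 hj' with h' | rfl
      · exact hn j' h'
      · exact h2

lemma row_line_of_mem (hp : PartialPerm x) {i j₀ j : ℕ} (hj : j₀ < j) (hx : x i j₀)
    (h : ∀ j', j₀ < j' → j' < j → ¬ skel x i j') : chainLen x (i + 1) j ≠ chainLen x i j := by
  induction j, hj using Nat.le_induction with
  | base => exact (hp.row_line_succ _ _).2 (Or.inl hx)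
  | succ j hj ih =>
    exact (hp.row_line_succ _ _).2 (Or.inr ⟨ih fun j' h1 h2 => h j' h1 (by omega),
      h j hj (by omega)⟩)

lemma exists_of_col_line (hp : PartialPerm x) {i j : ℕ}
    (h : chainLen x i (j + 1) ≠ chainLen x i j) :
    ∃ i₀ < i, x i₀ j ∧ ∀ i' < i, ¬ skel x i' j := by
  have := hp.transpose.exists_of_row_line (i := j) (j := i) (by simpa only [chainLen_flip] using h)
  simpa only [skel_flip, flip] using this

lemma col_line_of_mem (hp : PartialPerm x) {i₀ i j : ℕ} (hi : i₀ < i) (hx : x i₀ j)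
    (h : ∀ i', i₀ < i' → i' < i → ¬ skel x i' j) : chainLen x i (j + 1) ≠ chainLen x i j := by
  have := hp.transpose.row_line_of_mem (i := j) hi hx (by simpa only [skel_flip, flip] using h)
  simpa only [chainLen_flip] using this

lemma skeleton (hp : PartialPerm x) : PartialPerm (skel x) := by
  have key : ∀ {x : ℕ → ℕ → Prop}, PartialPerm x →
      ∀ i j j', skel x i j → skel x i j' → j = j' := by
    intro x hp i j j' h h'
    obtain ⟨_, _, _, hn⟩ := hp.exists_of_row_line h.1
    obtain ⟨_, _, _, hn'⟩ := hp.exists_of_row_line h'.1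
    rcases lt_trichotomy j j' with hlt | heq | hlt
    · exact absurd h (hn' j hlt)
    · exact heq
    · exact absurd h' (hn j' hlt)
  refine ⟨key hp, fun i i' j h h' => key hp.transpose j i i' ?_ ?_⟩ <;> rwa [skel_flip]

lemma iterate_skel (hp : PartialPerm x) (t : ℕ) : PartialPerm (skel^[t] x) := by
  induction t with
  | zero => exact hp
  | succ t ih => rw [Function.iterate_succ_apply']; exact ih.skeleton

lemma le_of_iterate_skel (hp : PartialPerm x) {t i j : ℕ} (h : skel^[t] x i j) :
    t ≤ j := by
  induction t generalizing j with
  | zero => omega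
  | succ t ih =>
    rw [Function.iterate_succ_apply'] at h
    obtain ⟨j₀, hj₀, hx, _⟩ := (hp.iterate_skel t).exists_of_row_line h.1
    have := ih hx
    omega

lemma _root_.chainLen_skel_le (x : ℕ → ℕ → Prop) (i j : ℕ) :
    chainLen (skel x) i j ≤ chainLen x i j := by
  induction i generalizing j with
  | zero => simp
  | succ i ihi =>
    induction j with
    | zero => simp
    | succ j ihj =>
      have hs := chainLen_steps x i j
      have hs' := chainLen_steps x (i + 1) j
      have hs'' := chainLen_steps x i (j + 1)
      by_cases hx : skel x i j
      · rw [chainLen_of_mem hx]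
        have := ihi j
        have h1 := hx.1
        omega
      · rw [chainLen_of_notMem hx]
        have := ihi (j + 1)
        omega

/-- The growth rule of a single layer, read backwards. -/
lemma _root_.chainLen_eq_min_sub (x : ℕ → ℕ → Prop) (i j : ℕ) :
    chainLen x i j = min (chainLen x (i + 1) j) (chainLen x i (j + 1)) -
      (open Classical in if skel x i j then 1 else 0) := by
  have h := chainLen_steps x i j
  by_cases hx : skel x i j
  · rw [if_pos hx]
    have h1 := hx.1
    have h2 := hx.2
    omega
  · rw [if_neg hx]
    unfold skel at hx
    omega

lemma _root_.shape_antitone (x : ℕ → ℕ → Prop) (i j : ℕ) : Antitone (shape x i j) := by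
  refine antitone_nat_of_succ_le fun t => ?_
  unfold shape
  rw [Function.iterate_succ_apply']
  exact chainLen_skel_le _ i j

lemma shape_eq_zero (hp : PartialPerm x) (i j : ℕ) : shape x i j j = 0 := by
  by_contra h
  obtain ⟨i', _, j', hj', hx⟩ := chainLen_pos_iff.1 (Nat.pos_of_ne_zero h)
  have := hp.le_of_iterate_skel hx
  omega

end PartialPerm

/-- `g` is `f` or is obtained from `f` by adding one box. -/
def BoxStep (f g : ℕ → ℕ) : Prop :=
  g = f ∨ ∃ s, ∀ t, g t = f t + if t = s then 1 else 0

lemma BoxStep.le {f g : ℕ → ℕ} (h : BoxStep f g) (t : ℕ) : f t ≤ g t := by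
  rcases h with rfl | ⟨s, hs⟩
  · exact le_rfl
  · rw [hs]; omega

namespace PartialPerm

variable {x y : ℕ → ℕ → Prop}

lemma exists_row_iff (hp : PartialPerm x) (i j : ℕ) :
    (∃ j' < j, x i j') ↔
      chainLen x (i + 1) j ≠ chainLen x i j ∨ ∃ j' < j, skel x i j' := by
  constructor
  · rintro ⟨j', hj', hx⟩
    by_contra! h
    exact hp.row_line_of_mem hj' hx (fun j'' _ h2 => h.2 j'' h2) h.1
  · rintro (h | ⟨j', hj', h⟩)
    · obtain ⟨j₀, hj₀, hx, _⟩ := hp.exists_of_row_line h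
      exact ⟨j₀, hj₀, hx⟩
    · obtain ⟨j₀, hj₀, hx, _⟩ := hp.exists_of_row_line h.1
      exact ⟨j₀, by omega, hx⟩

lemma shape_row_eq_of_empty (hp : PartialPerm x) {i j : ℕ} (h : ¬ ∃ j' < j, x i j') :
    shape x (i + 1) j = shape x i j := by
  have key : ∀ t, ¬ ∃ j' < j, skel^[t] x i j' := by
    intro t
    induction t with
    | zero => exact h
    | succ t ih =>
      rw [Function.iterate_succ_apply']
      rw [(hp.iterate_skel t).exists_row_iff] at ih
      exact fun h' => ih (Or.inr h')
  funext t
  have := key t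
  rw [(hp.iterate_skel t).exists_row_iff] at this
  push Not at this
  exact this.1

lemma shape_row_of_exists (hp : PartialPerm x) {i j : ℕ} (h : ∃ j' < j, x i j') :
    ∃ s, ∀ t, shape x (i + 1) j t = shape x i j t + if t = s then 1 else 0 := by
  classical
  have hex : ∃ t, ¬ ∃ j' < j, skel^[t] x i j' := by
    refine ⟨j, ?_⟩
    rintro ⟨j', hj', hx⟩
    have := hp.le_of_iterate_skel hx
    omega
  obtain ⟨s, hs⟩ : ∃ s, Nat.find hex = s + 1 := by
    refine Nat.exists_eq_succ_of_ne_zero fun h0 => ?_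
    have := Nat.find_spec hex
    rw [h0] at this
    exact this h
  have hlate : ∀ t, s + 1 ≤ t → ¬ ∃ j' < j, skel^[t] x i j' := by
    intro t ht
    induction t, ht using Nat.le_induction with
    | base => exact hs ▸ Nat.find_spec hex
    | succ t ht ih =>
      rw [Function.iterate_succ_apply']
      rw [(hp.iterate_skel t).exists_row_iff] at ih
      exact fun h' => ih (Or.inr h')
  have hearly : ∀ t, t ≤ s → ∃ j' < j, skel^[t] x i j' := fun t ht => by
    have := Nat.find_min hex (m := t) (by omega)
    exact not_not.1 this
  refine ⟨s, fun t => ?_⟩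
  unfold shape
  have hp' := hp.iterate_skel t
  rcases lt_trichotomy t s with hlt | rfl | hlt
  · rw [if_neg hlt.ne, add_zero]
    by_contra hne
    obtain ⟨_, _, _, hn⟩ := hp'.exists_of_row_line hne
    obtain ⟨j', hj', hx⟩ := hearly (t + 1) hlt
    rw [Function.iterate_succ_apply'] at hx
    exact hn j' hj' hx
  · have h1 := (hp'.exists_row_iff i j).1 (hearly t le_rfl)
    have h2 := hlate (t + 1) le_rfl
    rw [Function.iterate_succ_apply'] at h2
    have h3 := chainLen_steps (skel^[t] x) i j
    rw [if_pos rfl]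
    have := h1.resolve_right h2
    omega
  · have h1 := hlate t hlt
    rw [hp'.exists_row_iff] at h1
    push Not at h1
    rw [if_neg hlt.ne', add_zero, h1.1]

lemma boxStep_row (hp : PartialPerm x) (i j : ℕ) : BoxStep (shape x i j) (shape x (i + 1) j) := by
  by_cases h : ∃ j' < j, x i j'
  · exact Or.inr (hp.shape_row_of_exists h)
  · exact Or.inl (hp.shape_row_eq_of_empty h)

lemma boxStep_col (hp : PartialPerm x) (i j : ℕ) : BoxStep (shape x i j) (shape x i (j + 1)) := by
  rw [← shape_flip x, ← shape_flip x]
  exact hp.transpose.boxStep_row j i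

lemma shape_row_eq_iff (hp : PartialPerm x) (i j : ℕ) :
    shape x (i + 1) j = shape x i j ↔ ¬ ∃ j' < j, x i j' := by
  refine ⟨fun h hex => ?_, hp.shape_row_eq_of_empty⟩
  obtain ⟨s, hs⟩ := hp.shape_row_of_exists hex
  have := hs s
  rw [h, if_pos rfl] at this
  omega

lemma shape_col_eq_iff (hp : PartialPerm x) (i j : ℕ) :
    shape x i (j + 1) = shape x i j ↔ ¬ ∃ i' < i, x i' j := by
  rw [← shape_flip x, ← shape_flip x]
  exact hp.transpose.shape_row_eq_iff j i

end PartialPerm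

/-! ### Local rules and fillings with prescribed boundary shapes -/

lemma iterate_skel_mem_iff {x : ℕ → ℕ → Prop} (hp : PartialPerm x) (i j t : ℕ) :
    skel^[t] x i j ↔ max (shape x (i + 1) j t) (shape x i (j + 1) t) <
      shape x (i + 1) (j + 1) t :=
  (hp.iterate_skel t).mem_iff i j

lemma shape_backward {x y : ℕ → ℕ → Prop} (hx : PartialPerm x) (hy : PartialPerm y) {i j : ℕ}
    (h₁ : shape x (i + 1) j = shape y (i + 1) j) (h₂ : shape x i (j + 1) = shape y i (j + 1))
    (h₃ : shape x (i + 1) (j + 1) = shape y (i + 1) (j + 1)) :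
    (x i j ↔ y i j) ∧ shape x i j = shape y i j := by
  have key : ∀ t, skel^[t] x i j ↔ skel^[t] y i j := fun t => by
    rw [iterate_skel_mem_iff hx, iterate_skel_mem_iff hy, h₁, h₂, h₃]
  refine ⟨key 0, funext fun t => ?_⟩
  have h := key (t + 1)
  rw [Function.iterate_succ_apply', Function.iterate_succ_apply'] at h
  have e₁ := congrFun h₁ t
  have e₂ := congrFun h₂ t
  unfold shape at e₁ e₂ ⊢
  rw [chainLen_eq_min_sub, chainLen_eq_min_sub (skel^[t] y), e₁, e₂]
  by_cases hs : skel (skel^[t] x) i j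
  · rw [if_pos hs, if_pos (h.1 hs)]
  · rw [if_neg hs, if_neg (mt h.2 hs)]

/-- Given three corners of a square, the fourth corner together with the filling of the square. -/
lemma exists_backward {μ ν l : ℕ → ℕ} (hμ : Antitone μ) (hν : Antitone ν) (hl : Antitone l)
    (h₁ : BoxStep μ l) (h₂ : BoxStep ν l) :
    ∃ ρ : ℕ → ℕ, Antitone ρ ∧ BoxStep ρ μ ∧ BoxStep ρ ν ∧
      (max (μ 0) (ν 0) < l 0 → μ = ρ ∧ ν = ρ ∧ l 0 = ρ 0 + 1) ∧
      ∀ t, (ρ t ≠ μ t ∧ ρ t ≠ ν t → l (t + 1) = ρ (t + 1) + 1) ∧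
        (¬ (ρ t ≠ μ t ∧ ρ t ≠ ν t) → l (t + 1) = max (μ (t + 1)) (ν (t + 1))) := by
  rcases h₁ with rfl | ⟨s, hs⟩
  · refine ⟨ν, hν, h₂, Or.inl rfl, fun h => by omega, fun t => ⟨fun h => by omega, fun _ => ?_⟩⟩
    have := h₂.le (t + 1)
    omega
  rcases h₂ with rfl | ⟨s', hs'⟩
  · refine ⟨μ, hμ, Or.inl rfl, Or.inr ⟨s, hs⟩, fun h => by omega,
      fun t => ⟨fun h => by omega, fun _ => ?_⟩⟩
    have := hs (t + 1)
    omega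
  by_cases hss : s = s'
  · subst hss
    have hμν : μ = ν := funext fun t => by have := hs t; have := hs' t; omega
    subst hμν
    cases s with
    | zero =>
      refine ⟨μ, hμ, Or.inl rfl, Or.inl rfl, fun _ => ⟨rfl, rfl, by simpa using hs 0⟩,
        fun t => ⟨fun h => by omega, fun _ => ?_⟩⟩
      have := hs (t + 1)
      simpa using this
    | succ s =>
      have hlt : μ (s + 1) < μ s := by
        have h1 := hl (Nat.le_succ s)
        have h2 := hs s
        have h3 := hs (s + 1)
        simp only [Nat.succ_eq_add_one, left_eq_add, one_ne_zero, if_false, if_true] at h1 h2 h3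
        simp at h2
        omega
      have hstep : BoxStep (fun t => μ t - if t = s then 1 else 0) μ := by
        refine Or.inr ⟨s, fun t => ?_⟩
        dsimp only
        split_ifs with h
        · subst h; omega
        · rfl
      refine ⟨fun t => μ t - if t = s then 1 else 0, antitone_nat_of_succ_le fun t => ?_,
        hstep, hstep, fun h => ?_, fun t => ⟨fun h => ?_, fun h => ?_⟩⟩
      · have := hμ (Nat.le_succ t)
        dsimp only [Nat.succ_eq_add_one] at this ⊢
        split_ifs with h1 h2 h2
        · omega
        · omega
        · subst h2; omega
        · omega
      · have := hs 0
        simp at this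
        omega
      · have hts : t = s := by
          by_contra hne
          simp [hne] at h
        subst hts
        have := hs (t + 1)
        simpa using this
      · have hts : t ≠ s := by
          rintro rfl
          simp at h
          omega
        have := hs (t + 1)
        simpa [hts] using this
  · refine ⟨fun t => min (μ t) (ν t), hμ.min hν, Or.inr ⟨s', fun t => ?_⟩,
      Or.inr ⟨s, fun t => ?_⟩, fun h => ?_, fun t => ⟨fun h => ?_, fun _ => ?_⟩⟩
    · have h1 := hs t
      have h2 := hs' t
      dsimp only
      split_ifs at h1 h2 ⊢ <;> omega
    · have h1 := hs t
      have h2 := hs' t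
      dsimp only
      split_ifs at h1 h2 ⊢ <;> omega
    · have h1 := hs 0
      have h2 := hs' 0
      split_ifs at h1 h2 <;> omega
    · have h1 := hs t
      have h2 := hs' t
      dsimp only at h
      split_ifs at h1 h2 <;> omega
    · have h1 := hs (t + 1)
      have h2 := hs' (t + 1)
      split_ifs at h1 h2 <;> omega

/-- The vertices on the outer boundary of a Ferrers board. -/
def OnBoundary (F : ℕ → ℕ → Prop) (i j : ℕ) : Prop :=
  ¬ F i j ∧ (i = 0 ∨ j = 0 ∨ F (i - 1) (j - 1))

/-- A set of cells closed under decreasing coordinates. -/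
def IsFerrers (F : ℕ → ℕ → Prop) : Prop :=
  ∀ i j i' j', F i j → i' ≤ i → j' ≤ j → F i' j'

/-- Admissible labellings of the boundary of a Ferrers board by partitions. -/
structure IsBoundaryLabel (F : ℕ → ℕ → Prop) (l : ℕ → ℕ → ℕ → ℕ) : Prop where
  antitone : ∀ i j, OnBoundary F i j → Antitone (l i j)
  left : ∀ j, OnBoundary F 0 j → l 0 j = 0
  right : ∀ i, OnBoundary F i 0 → l i 0 = 0
  row : ∀ i j, OnBoundary F i j → OnBoundary F (i + 1) j → BoxStep (l i j) (l (i + 1) j)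
  col : ∀ i j, OnBoundary F i j → OnBoundary F i (j + 1) → BoxStep (l i j) (l i (j + 1))

lemma shape_zero_left (x : ℕ → ℕ → Prop) (j : ℕ) : shape x 0 j = 0 := by
  funext t; simp [shape]

lemma shape_zero_right (x : ℕ → ℕ → Prop) (i : ℕ) : shape x i 0 = 0 := by
  funext t; simp [shape]

lemma shape_succ_succ {x : ℕ → ℕ → Prop} {i j : ℕ} {l : ℕ → ℕ}
    (h₁ : x i j → l 0 = shape x i j 0 + 1)
    (h₂ : ¬ x i j → l 0 = max (shape x (i + 1) j 0) (shape x i (j + 1) 0))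
    (h₃ : ∀ t, (shape x i j t ≠ shape x (i + 1) j t ∧ shape x i j t ≠ shape x i (j + 1) t →
        l (t + 1) = shape x i j (t + 1) + 1) ∧
      (¬ (shape x i j t ≠ shape x (i + 1) j t ∧ shape x i j t ≠ shape x i (j + 1) t) →
        l (t + 1) = max (shape x (i + 1) j (t + 1)) (shape x i (j + 1) (t + 1)))) :
    shape x (i + 1) (j + 1) = l := by
  funext t
  cases t with
  | zero =>
    by_cases hx : x i j
    · rw [h₁ hx]; exact chainLen_of_mem hx
    · rw [h₂ hx]; exact chainLen_of_notMem hx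
  | succ t =>
    have hiff : skel^[t + 1] x i j ↔
        shape x i j t ≠ shape x (i + 1) j t ∧ shape x i j t ≠ shape x i (j + 1) t := by
      rw [Function.iterate_succ_apply']
      exact and_congr ne_comm ne_comm
    by_cases hx : skel^[t + 1] x i j
    · rw [(h₃ t).1 (hiff.1 hx)]; exact chainLen_of_mem hx
    · rw [(h₃ t).2 (mt hiff.2 hx)]; exact chainLen_of_notMem hx

theorem exists_filling_of_label (S : Finset (ℕ × ℕ)) (hS : IsFerrers fun i j => (i, j) ∈ S)
    (l : ℕ → ℕ → ℕ → ℕ) (hl : IsBoundaryLabel (fun i j => (i, j) ∈ S) l) :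
    ∃ x, PartialPerm x ∧ (∀ i j, x i j → (i, j) ∈ S) ∧
      ∀ i j, OnBoundary (fun i j => (i, j) ∈ S) i j → shape x i j = l i j := by
  induction hn : S.card generalizing S l with
  | zero =>
    rw [Finset.card_eq_zero] at hn
    subst hn
    refine ⟨fun _ _ => False, ⟨by simp, by simp⟩, by simp, fun i j h => ?_⟩
    rcases h.2 with rfl | rfl | h'
    · rw [shape_zero_left, hl.left j h]
    · rw [shape_zero_right, hl.right i h]
    · simp at h'
  | succ n ih =>
    obtain ⟨⟨a, b⟩, hab, hmax⟩ := S.exists_max_image (fun p => p.1 + p.2)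
      (Finset.card_pos.1 (by omega))
    have hmax' : ∀ i j, (i, j) ∈ S → a ≤ i → b ≤ j → i = a ∧ j = b := fun i j h h1 h2 => by
      have := hmax (i, j) h
      dsimp only at this
      omega
    have hmem : ∀ i j, (i, j) ∈ S.erase (a, b) ↔ ¬ (i = a ∧ j = b) ∧ (i, j) ∈ S := by simp
    have b₁ : OnBoundary (fun i j => (i, j) ∈ S) (a + 1) b :=
      ⟨fun h => by have := hmax' _ _ h; omega, by
        rcases Nat.eq_zero_or_pos b with h | h
        · exact Or.inr (Or.inl h)
        · exact Or.inr (Or.inr (hS _ _ _ _ hab (by omega) (by omega)))⟩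
    have b₂ : OnBoundary (fun i j => (i, j) ∈ S) a (b + 1) :=
      ⟨fun h => by have := hmax' _ _ h; omega, by
        rcases Nat.eq_zero_or_pos a with h | h
        · exact Or.inl h
        · exact Or.inr (Or.inr (hS _ _ _ _ hab (by omega) (by omega)))⟩
    have b₃ : OnBoundary (fun i j => (i, j) ∈ S) (a + 1) (b + 1) :=
      ⟨fun h => by have := hmax' _ _ h; omega, Or.inr (Or.inr hab)⟩
    obtain ⟨ρ, hρ, hρμ, hρν, hc, hrule⟩ := exists_backward (hl.antitone _ _ b₁)
      (hl.antitone _ _ b₂) (hl.antitone _ _ b₃) (hl.col _ _ b₁ b₃) (hl.row _ _ b₂ b₃)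
    have hbd : ∀ i j, OnBoundary (fun i j => (i, j) ∈ S.erase (a, b)) i j →
        ¬ (i = a ∧ j = b) → OnBoundary (fun i j => (i, j) ∈ S) i j := by
      intro i j h hne
      refine ⟨fun h' => h.1 ((hmem i j).2 ⟨hne, h'⟩), ?_⟩
      rcases h.2 with h' | h' | h'
      · exact Or.inl h'
      · exact Or.inr (Or.inl h')
      · exact Or.inr (Or.inr ((hmem _ _).1 h').2)
    have hbd' : ∀ i j, OnBoundary (fun i j => (i, j) ∈ S) i j → ¬ (i = a + 1 ∧ j = b + 1) →
        OnBoundary (fun i j => (i, j) ∈ S.erase (a, b)) i j := by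
      intro i j h hne
      refine ⟨fun h' => h.1 ((hmem i j).1 h').2, ?_⟩
      by_cases h0 : i = 0 ∨ j = 0
      · tauto
      · rcases h.2 with h' | h' | h'
        · exact Or.inl h'
        · exact Or.inr (Or.inl h')
        · exact Or.inr (Or.inr ((hmem _ _).2 ⟨by omega, h'⟩))
    have hpred₁ : ∀ i, i + 1 = a → ¬ OnBoundary (fun i j => (i, j) ∈ S.erase (a, b)) i b :=
      fun i hi h => h.1 ((hmem _ _).2 ⟨by omega, hS _ _ _ _ hab (by omega) le_rfl⟩)
    have hpred₂ : ∀ j, j + 1 = b → ¬ OnBoundary (fun i j => (i, j) ∈ S.erase (a, b)) a j :=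
      fun j hj h => h.1 ((hmem _ _).2 ⟨by omega, hS _ _ _ _ hab le_rfl (by omega)⟩)
    let l' : ℕ → ℕ → ℕ → ℕ := fun i j => if i = a ∧ j = b then ρ else l i j
    have l'_self : l' a b = ρ := if_pos ⟨rfl, rfl⟩
    have l'_ne : ∀ {i j}, ¬ (i = a ∧ j = b) → l' i j = l i j := fun h => if_neg h
    obtain ⟨x, hx, hxS, hxl⟩ := ih (S.erase (a, b))
      (fun i j i' j' h hi hj => by
        change (i, j) ∈ S.erase (a, b) at h
        rw [hmem] at h ⊢
        refine ⟨fun h' => h.1 (hmax' i j h.2 (by omega) (by omega)), hS _ _ _ _ h.2 hi hj⟩)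
      l'
      { antitone := fun i j h => by
          by_cases hij : i = a ∧ j = b
          · rw [hij.1, hij.2, l'_self]; exact hρ
          · rw [l'_ne hij]; exact hl.antitone i j (hbd i j h hij)
        left := fun j h => by
          by_cases hij : 0 = a ∧ j = b
          · rw [hij.1, hij.2, l'_self]
            funext t
            have h1 := hρν.le t
            obtain ⟨rfl, rfl⟩ := hij
            rw [hl.left _ b₂] at h1
            exact Nat.le_zero.1 h1
          · rw [l'_ne hij]; exact hl.left j (hbd _ _ h hij)
        right := fun i h => by
          by_cases hij : i = a ∧ 0 = b
          · rw [hij.1, hij.2, l'_self]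
            funext t
            have h1 := hρμ.le t
            obtain ⟨rfl, rfl⟩ := hij
            rw [hl.right _ b₁] at h1
            exact Nat.le_zero.1 h1
          · rw [l'_ne hij]; exact hl.right i (hbd _ _ h hij)
        row := fun i j h h' => by
          by_cases hij : i = a ∧ j = b
          · obtain ⟨rfl, rfl⟩ := hij
            rw [l'_self, l'_ne (by omega)]; exact hρμ
          · by_cases hij' : i + 1 = a ∧ j = b
            · obtain ⟨h1, rfl⟩ := hij'
              exact absurd h (hpred₁ i h1)
            · rw [l'_ne hij, l'_ne hij']
              exact hl.row i j (hbd _ _ h hij) (hbd _ _ h' hij')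
        col := fun i j h h' => by
          by_cases hij : i = a ∧ j = b
          · obtain ⟨rfl, rfl⟩ := hij
            rw [l'_self, l'_ne (by omega)]; exact hρν
          · by_cases hij' : i = a ∧ j + 1 = b
            · obtain ⟨rfl, h1⟩ := hij'
              exact absurd h (hpred₂ j h1)
            · rw [l'_ne hij, l'_ne hij']
              exact hl.col i j (hbd _ _ h hij) (hbd _ _ h' hij') }
      (by rw [Finset.card_erase_of_mem hab]; omega)
    have hxab : ¬ x a b := fun h => by have := hxS a b h; simp at this
    have e₀ : shape x a b = ρ := by
      rw [hxl a b ⟨by simp, ?_⟩, l'_self]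
      by_cases h0 : a = 0 ∨ b = 0
      · tauto
      · exact Or.inr (Or.inr ((hmem _ _).2 ⟨by omega, hS _ _ _ _ hab (by omega) (by omega)⟩))
    have e₁ : shape x (a + 1) b = l (a + 1) b := by
      rw [hxl _ _ (hbd' _ _ b₁ (by omega)), l'_ne (by omega)]
    have e₂ : shape x a (b + 1) = l a (b + 1) := by
      rw [hxl _ _ (hbd' _ _ b₂ (by omega)), l'_ne (by omega)]
    let c : Prop := max (l (a + 1) b 0) (l a (b + 1) 0) < l (a + 1) (b + 1) 0
    have hrow : c → ∀ j, ¬ x a j := fun h j hj => by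
      have h1 := (hx.shape_row_eq_iff a b).1 (by rw [e₀, e₁, (hc h).1])
      have h2 := (hmem _ _).1 (hxS a j hj)
      refine h1 ⟨j, ?_, hj⟩
      by_contra hlt
      exact h2.1 (hmax' _ _ h2.2 le_rfl (by omega))
    have hcol : c → ∀ i, ¬ x i b := fun h i hi => by
      have h1 := (hx.shape_col_eq_iff a b).1 (by rw [e₀, e₂, (hc h).2.1])
      have h2 := (hmem _ _).1 (hxS i b hi)
      refine h1 ⟨i, ?_, hi⟩
      by_contra hlt
      exact h2.1 (hmax' _ _ h2.2 (by omega) le_rfl)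
    have hcongr : ∀ i j, ¬ (a < i ∧ b < j) →
        shape (fun i j => x i j ∨ (c ∧ i = a ∧ j = b)) i j = shape x i j := by
      refine fun i j hij => shape_congr fun i' hi' j' hj' => ⟨fun h => ?_, Or.inl⟩
      rcases h with h | ⟨_, rfl, rfl⟩
      · exact h
      · exact absurd ⟨hi', hj'⟩ hij
    refine ⟨fun i j => x i j ∨ (c ∧ i = a ∧ j = b), ⟨?_, ?_⟩, ?_, ?_⟩
    · rintro i j j' (h | ⟨h, rfl, rfl⟩) (h' | ⟨h', h'', rfl⟩)
      · exact hx.1 i j j' h h'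
      · subst h''; exact absurd h (hrow h' j)
      · exact absurd h' (hrow h j')
      · rfl
    · rintro i i' j (h | ⟨h, rfl, rfl⟩) (h' | ⟨h', rfl, h''⟩)
      · exact hx.2 i i' j h h'
      · subst h''; exact absurd h (hcol h' i)
      · exact absurd h' (hcol h i')
      · rfl
    · rintro i j (h | ⟨_, rfl, rfl⟩)
      · exact ((hmem _ _).1 (hxS i j h)).2
      · exact hab
    · intro i j h
      by_cases hij : i = a + 1 ∧ j = b + 1
      · obtain ⟨rfl, rfl⟩ := hij
        apply shape_succ_succ
        · rintro (h' | ⟨h', -⟩)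
          · exact absurd h' hxab
          · rw [hcongr a b (by omega), e₀, (hc h').2.2]
        · intro h'
          rw [hcongr (a + 1) b (by omega), hcongr a (b + 1) (by omega), e₁, e₂]
          have hnc : ¬ c := fun hc' => h' (Or.inr ⟨hc', rfl, rfl⟩)
          have h1 := (hl.col _ _ b₁ b₃).le 0
          have h2 := (hl.row _ _ b₂ b₃).le 0
          dsimp only [c] at hnc
          omega
        · intro t
          rw [hcongr (a + 1) b (by omega), hcongr a (b + 1) (by omega), hcongr a b (by omega),
            e₀, e₁, e₂]
          exact hrule t
      · have hlt : ¬ (a < i ∧ b < j) := fun ⟨h1, h2⟩ => by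
          rcases h.2 with h' | h' | h'
          · omega
          · omega
          · have := hmax' _ _ h' (by omega) (by omega)
            omega
        rw [hcongr i j hlt, hxl i j (hbd' i j h hij), l'_ne ?_]
        rintro ⟨rfl, rfl⟩
        exact h.1 hab

theorem filling_unique {F : ℕ → ℕ → Prop} (hF : IsFerrers F) {N : ℕ}
    (hN : ∀ i j, F i j → i < N ∧ j < N) {x y : ℕ → ℕ → Prop} (hx : PartialPerm x)
    (hy : PartialPerm y) (hxF : ∀ i j, x i j → F i j) (hyF : ∀ i j, y i j → F i j)
    (h : ∀ i j, OnBoundary F i j → shape x i j = shape y i j) : x = y := by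
  have key : ∀ d i j, 2 * N ≤ i + j + d → (i = 0 ∨ j = 0 ∨ F (i - 1) (j - 1)) →
      shape x i j = shape y i j ∧ (F i j → (x i j ↔ y i j)) := by
    intro d
    induction d using Nat.strong_induction_on with
    | _ d ih =>
      intro i j hd hij
      by_cases hf : F i j
      · have := hN i j hf
        have h₁ := ih (d - 1) (by omega) (i + 1) j (by omega) (by
          rcases Nat.eq_zero_or_pos j with h | h
          · exact Or.inr (Or.inl h)
          · exact Or.inr (Or.inr (hF _ _ _ _ hf (by omega) (by omega))))
        have h₂ := ih (d - 1) (by omega) i (j + 1) (by omega) (by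
          rcases Nat.eq_zero_or_pos i with h | h
          · exact Or.inl h
          · exact Or.inr (Or.inr (hF _ _ _ _ hf (by omega) (by omega))))
        have h₃ := ih (d - 1) (by omega) (i + 1) (j + 1) (by omega) (Or.inr (Or.inr hf))
        have := shape_backward hx hy h₁.1 h₂.1 h₃.1
        exact ⟨this.2, fun _ => this.1⟩
      · exact ⟨h i j ⟨hf, hij⟩, fun h => absurd h hf⟩
  ext i j
  by_cases hf : F i j
  · refine (key (2 * N) i j (by omega) ?_).2 hf
    by_cases h0 : i = 0 ∨ j = 0
    · tauto
    · exact Or.inr (Or.inr (hF _ _ _ _ hf (by omega) (by omega)))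
  · exact ⟨fun h => absurd (hxF i j h) hf, fun h => absurd (hyF i j h) hf⟩

/-! ### Conjugation of partitions -/

/-- Partitions as antitone, eventually vanishing sequences. -/
def IsPartition (f : ℕ → ℕ) : Prop := Antitone f ∧ ∃ N, f N = 0

/-- The conjugate partition. -/
noncomputable def conjPartition (f : ℕ → ℕ) (i : ℕ) : ℕ := sInf {j | f j ≤ i}

lemma IsPartition.lt_conj_iff {f : ℕ → ℕ} (hf : IsPartition f) {i j : ℕ} :
    j < conjPartition f i ↔ i < f j := by
  constructor
  · intro h
    have := Nat.notMem_of_lt_sInf h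
    simpa using this
  · intro h
    by_contra! hle
    obtain ⟨N, hN⟩ := hf.2
    have hne : {j | f j ≤ i}.Nonempty := ⟨N, by simp [hN]⟩
    have h1 : f (conjPartition f i) ≤ i := Nat.sInf_mem hne
    have h2 := hf.1 hle
    omega

lemma IsPartition.conj {f : ℕ → ℕ} (hf : IsPartition f) : IsPartition (conjPartition f) := by
  refine ⟨fun i i' h => ?_, f 0, ?_⟩
  · by_contra! hlt
    have h1 := hf.lt_conj_iff.1 hlt
    have h2 := mt hf.lt_conj_iff.2 (lt_irrefl (conjPartition f i))
    omega
  · by_contra hne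
    have := hf.lt_conj_iff.1 (Nat.pos_of_ne_zero hne)
    omega

lemma IsPartition.conj_conj {f : ℕ → ℕ} (hf : IsPartition f) :
    conjPartition (conjPartition f) = f := by
  funext i
  refine eq_of_forall_lt_iff fun j => ?_
  rw [hf.conj.lt_conj_iff, hf.lt_conj_iff]

lemma conjPartition_inj {f g : ℕ → ℕ} (hf : IsPartition f) (hg : IsPartition g) :
    conjPartition f = conjPartition g ↔ f = g :=
  ⟨fun h => by rw [← hf.conj_conj, h, hg.conj_conj], fun h => h ▸ rfl⟩

lemma conjPartition_zero : conjPartition 0 = 0 := by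
  funext i
  exact Nat.sInf_eq_zero.2 (Or.inl (by simp))

lemma BoxStep.conj {f g : ℕ → ℕ} (hf : IsPartition f) (hg : IsPartition g) (h : BoxStep f g) :
    BoxStep (conjPartition f) (conjPartition g) := by
  rcases h with rfl | ⟨s, hs⟩
  · exact Or.inl rfl
  refine Or.inr ⟨f s, fun i => eq_of_forall_lt_iff fun j => ?_⟩
  rw [hg.lt_conj_iff, hs]
  have hc : j < conjPartition f i ↔ i < f j := hf.lt_conj_iff
  by_cases hi : i = f s
  · have hval : conjPartition f i = s := by
      refine eq_of_forall_lt_iff fun t => ?_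
      rw [hf.lt_conj_iff, hi]
      constructor
      · intro h
        by_contra! hle
        have := hf.1 hle
        omega
      · intro h
        have h1 := hg.1 h.le
        rw [hs, hs, if_pos rfl, if_neg h.ne] at h1
        omega
    rw [if_pos hi]
    by_cases hj : j = s
    · subst hj
      rw [hval, if_pos rfl]
      omega
    · rw [if_neg hj]
      omega
  · rw [if_neg hi]
    by_cases hj : j = s
    · subst hj
      rw [if_pos rfl]
      omega
    · rw [if_neg hj]
      omega

lemma PartialPerm.shape_isPartition {x : ℕ → ℕ → Prop} (hx : PartialPerm x) (i j : ℕ) :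
    IsPartition (shape x i j) :=
  ⟨shape_antitone x i j, j, hx.shape_eq_zero i j⟩

/-- `x` and `y` are fillings of `F` whose boundary shapes are conjugate. -/
structure ConjFilling (F : ℕ → ℕ → Prop) (x y : ℕ → ℕ → Prop) : Prop where
  left : PartialPerm x
  right : PartialPerm y
  left_subset : ∀ i j, x i j → F i j
  right_subset : ∀ i j, y i j → F i j
  shape_eq : ∀ i j, OnBoundary F i j → shape y i j = conjPartition (shape x i j)

lemma ConjFilling.symm {F x y : ℕ → ℕ → Prop} (h : ConjFilling F x y) : ConjFilling F y x :=
  ⟨h.right, h.left, h.right_subset, h.left_subset, fun i j hij => by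
    rw [h.shape_eq i j hij, (h.left.shape_isPartition i j).conj_conj]⟩

lemma IsFerrers.transpose {F : ℕ → ℕ → Prop} (hF : IsFerrers F) : IsFerrers (flip F) :=
  fun i j i' j' h hi hj => hF j i j' i' h hj hi

lemma ConjFilling.transpose {F x y : ℕ → ℕ → Prop} (h : ConjFilling F x y) :
    ConjFilling (flip F) (flip x) (flip y) :=
  ⟨h.left.transpose, h.right.transpose, fun i j => h.left_subset j i,
    fun i j => h.right_subset j i, fun i j hij => by
      rw [shape_flip, shape_flip]
      exact h.shape_eq j i ⟨hij.1, by have := hij.2; simp only [flip] at this; tauto⟩⟩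

lemma ConjFilling.unique {F x y z : ℕ → ℕ → Prop} (hF : IsFerrers F) {N : ℕ}
    (hN : ∀ i j, F i j → i < N ∧ j < N) (h : ConjFilling F x y) (h' : ConjFilling F x z) :
    y = z :=
  filling_unique hF hN h.right h'.right h.right_subset h'.right_subset fun i j hij => by
    rw [h.shape_eq i j hij, h'.shape_eq i j hij]

lemma ConjFilling.row_iff {F x y : ℕ → ℕ → Prop} (hF : IsFerrers F) {N : ℕ}
    (hN : ∀ i j, F i j → i < N ∧ j < N) (h : ConjFilling F x y) (i : ℕ) :
    (∃ j, x i j) ↔ ∃ j, y i j := by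
  classical
  have hex : ∃ j, ¬ F i j := ⟨N, fun h => by have := hN _ _ h; omega⟩
  set J := Nat.find hex with hJ
  have hJ1 : ¬ F i J := Nat.find_spec hex
  have hJ2 : ∀ j, F i j → j < J := fun j hj => by
    by_contra! hle
    exact hJ1 (hF _ _ _ _ hj le_rfl hle)
  have hJ3 : J = 0 ∨ F i (J - 1) := by
    rcases Nat.eq_zero_or_pos J with h0 | h0
    · exact Or.inl h0
    · exact Or.inr (not_not.1 (Nat.find_min hex (m := J - 1) (by omega)))
  have b₀ : OnBoundary F i J := ⟨hJ1, by
    rcases hJ3 with h0 | h0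
    · exact Or.inr (Or.inl h0)
    · exact Or.inr (Or.inr (hF _ _ _ _ h0 (by omega) le_rfl))⟩
  have b₁ : OnBoundary F (i + 1) J := ⟨fun h => hJ1 (hF _ _ _ _ h (by omega) le_rfl), by
    rcases hJ3 with h0 | h0
    · exact Or.inr (Or.inl h0)
    · exact Or.inr (Or.inr h0)⟩
  have key : shape y (i + 1) J = shape y i J ↔ shape x (i + 1) J = shape x i J := by
    rw [h.shape_eq _ _ b₀, h.shape_eq _ _ b₁]
    exact conjPartition_inj (h.left.shape_isPartition _ _) (h.left.shape_isPartition _ _)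
  rw [h.left.shape_row_eq_iff, h.right.shape_row_eq_iff, not_iff_not] at key
  constructor
  · rintro ⟨j, hj⟩
    obtain ⟨j', -, hj'⟩ := key.2 ⟨j, hJ2 _ (h.left_subset _ _ hj), hj⟩
    exact ⟨j', hj'⟩
  · rintro ⟨j, hj⟩
    obtain ⟨j', -, hj'⟩ := key.1 ⟨j, hJ2 _ (h.right_subset _ _ hj), hj⟩
    exact ⟨j', hj'⟩

lemma ConjFilling.col_iff {F x y : ℕ → ℕ → Prop} (hF : IsFerrers F) {N : ℕ}
    (hN : ∀ i j, F i j → i < N ∧ j < N) (h : ConjFilling F x y) (j : ℕ) :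
    (∃ i, x i j) ↔ ∃ i, y i j :=
  h.transpose.row_iff hF.transpose (N := N) (fun i j hij => (hN j i hij).symm) j

theorem exists_conjFilling {F x : ℕ → ℕ → Prop} (hF : IsFerrers F) {N : ℕ}
    (hN : ∀ i j, F i j → i < N ∧ j < N) (hx : PartialPerm x) (hxF : ∀ i j, x i j → F i j) :
    ∃ y, ConjFilling F x y := by
  classical
  have hmem : ∀ i j, (i, j) ∈ ((Finset.range N ×ˢ Finset.range N).filter fun p => F p.1 p.2) ↔
      F i j := fun i j => by
    simp only [Finset.mem_filter, Finset.mem_product, Finset.mem_range, and_iff_right_iff_imp]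
    exact hN i j
  have hFS : (fun i j => (i, j) ∈
      ((Finset.range N ×ˢ Finset.range N).filter fun p => F p.1 p.2)) = F := by
    ext i j; exact hmem i j
  have hpart := hx.shape_isPartition
  obtain ⟨y, hy, hyF, hyl⟩ := exists_filling_of_label
    ((Finset.range N ×ˢ Finset.range N).filter fun p => F p.1 p.2) (by rw [hFS]; exact hF)
    (fun i j => conjPartition (shape x i j))
    { antitone := fun i j _ => (hpart i j).conj.1
      left := fun j _ => by rw [shape_zero_left, conjPartition_zero]
      right := fun i _ => by rw [shape_zero_right, conjPartition_zero]
      row := fun i j _ _ => (hx.boxStep_row i j).conj (hpart _ _) (hpart _ _)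
      col := fun i j _ _ => (hx.boxStep_col i j).conj (hpart _ _) (hpart _ _) }
  rw [hFS] at hyl
  exact ⟨y, hx, hy, hxF, fun i j h => (hmem i j).1 (hyF i j h), hyl⟩

/-! ### Chains and antichains -/

/-- `x` has `k` cells in `[0, i) × [0, j)` increasing in both coordinates. -/
def HasChain (x : ℕ → ℕ → Prop) (k i j : ℕ) : Prop :=
  ∃ r c : ℕ → ℕ, (∀ s < k, r s < i ∧ c s < j ∧ x (r s) (c s)) ∧
    ∀ s, s + 1 < k → r s < r (s + 1) ∧ c s < c (s + 1)

/-- `x` has `k` cells in `[0, i) × [0, j)` with increasing rows and decreasing columns. -/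
def HasAntichain (x : ℕ → ℕ → Prop) (k i j : ℕ) : Prop :=
  ∃ r c : ℕ → ℕ, (∀ s < k, r s < i ∧ c s < j ∧ x (r s) (c s)) ∧
    ∀ s, s + 1 < k → r s < r (s + 1) ∧ c (s + 1) < c s

lemma HasChain.mono {x : ℕ → ℕ → Prop} {k i j i' j' : ℕ} (h : HasChain x k i j) (hi : i ≤ i')
    (hj : j ≤ j') : HasChain x k i' j' := by
  obtain ⟨r, c, h1, h2⟩ := h
  exact ⟨r, c, fun s hs => ⟨(h1 s hs).1.trans_le hi, (h1 s hs).2.1.trans_le hj, (h1 s hs).2.2⟩, h2⟩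

lemma HasAntichain.mono {x : ℕ → ℕ → Prop} {k i j i' j' : ℕ} (h : HasAntichain x k i j)
    (hi : i ≤ i') (hj : j ≤ j') : HasAntichain x k i' j' := by
  obtain ⟨r, c, h1, h2⟩ := h
  exact ⟨r, c, fun s hs => ⟨(h1 s hs).1.trans_le hi, (h1 s hs).2.1.trans_le hj, (h1 s hs).2.2⟩, h2⟩

lemma hasChain_of_le_chainLen {x : ℕ → ℕ → Prop} {k i j : ℕ} (h : k ≤ chainLen x i j) :
    HasChain x k i j := by
  induction i generalizing j k with
  | zero => simp at h; subst h; exact ⟨id, id, by simp, by simp⟩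
  | succ i ihi =>
    induction j generalizing k with
    | zero => simp at h; subst h; exact ⟨id, id, by simp, by simp⟩
    | succ j ihj =>
      by_cases hx : x i j
      · rw [chainLen_of_mem hx] at h
        obtain ⟨r, c, h1, h2⟩ := ihi (j := j) (k := k - 1) (by omega)
        refine ⟨fun s => if s < k - 1 then r s else i, fun s => if s < k - 1 then c s else j,
          fun s hs => ?_, fun s hs => ?_⟩
        · dsimp only
          split_ifs with h'
          · have := h1 s h'
            exact ⟨by omega, by omega, this.2.2⟩
          · exact ⟨by omega, by omega, hx⟩
        · dsimp only
          have hs' : s < k - 1 := by omega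
          have h1s := h1 s hs'
          by_cases h' : s + 1 < k - 1
          · simpa only [if_pos hs', if_pos h'] using h2 s h'
          · simpa only [if_pos hs', if_neg h'] using And.intro h1s.1 h1s.2.1
      · rw [chainLen_of_notMem hx, le_max_iff] at h
        rcases h with h | h
        · exact (ihj h).mono le_rfl (by omega)
        · exact (ihi h).mono (by omega) le_rfl

lemma hasChain_iff {x : ℕ → ℕ → Prop} {k i j : ℕ} : HasChain x k i j ↔ k ≤ chainLen x i j := by
  refine ⟨?_, hasChain_of_le_chainLen⟩
  rintro ⟨r, c, h1, h2⟩
  have key : ∀ s, s < k → s + 1 ≤ chainLen x (r s + 1) (c s + 1) := by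
    intro s
    induction s with
    | zero =>
      intro hs
      rw [chainLen_of_mem (h1 0 hs).2.2]
      omega
    | succ s ih =>
      intro hs
      rw [chainLen_of_mem (h1 _ hs).2.2]
      have h3 := ih (by omega)
      have h4 := chainLen_mono x (show r s + 1 ≤ r (s + 1) from (h2 s hs).1)
        (show c s + 1 ≤ c (s + 1) from (h2 s hs).2)
      omega
  rcases Nat.eq_zero_or_pos k with rfl | hk
  · omega
  · have h3 := key (k - 1) (by omega)
    have h4 := h1 (k - 1) (by omega)
    have h5 := chainLen_mono x (show r (k - 1) + 1 ≤ i from h4.1)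
      (show c (k - 1) + 1 ≤ j from h4.2.1)
    omega

namespace PartialPerm

variable {x : ℕ → ℕ → Prop}

/-- Two cells of `x` in antichain position have a cell of the skeleton between them. -/
lemma exists_skel_between (hx : PartialPerm x) {i₁ i₂ j₁ j₂ : ℕ} (hi : i₁ < i₂) (hj : j₂ < j₁)
    (h₁ : x i₁ j₁) (h₂ : x i₂ j₂) :
    ∃ i j, i₁ < i ∧ i ≤ i₂ ∧ j₂ < j ∧ j ≤ j₁ ∧ skel x i j := by
  by_contra! hn
  have hrow := hx.row_line_of_mem hj h₂ fun j' h1 h2 => hn i₂ j' hi le_rfl h1 h2.le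
  have hcol := hx.col_line_of_mem hi h₁ fun i' h1 h2 => hn i' j₁ h1 h2.le hj le_rfl
  exact hn i₂ j₁ hi le_rfl hj le_rfl ⟨hrow, hcol⟩

/-- Two cells of the skeleton in antichain position have a cell of `x` between them. -/
lemma exists_mem_between (hx : PartialPerm x) {u₁ u₂ v₁ v₂ : ℕ} (hu : u₁ < u₂) (hv : v₂ < v₁)
    (h₁ : skel x u₁ v₁) (h₂ : skel x u₂ v₂) :
    ∃ i j, u₁ ≤ i ∧ i < u₂ ∧ v₂ ≤ j ∧ j < v₁ ∧ x i j := by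
  by_contra! hn
  obtain ⟨c, hc, hxc, hcn⟩ := hx.exists_of_row_line h₁.1
  obtain ⟨r, hr, hxr, hrn⟩ := hx.exists_of_col_line h₂.2
  have hc' : c < v₂ := by
    by_contra! hle
    exact hn u₁ c le_rfl hu hle hc hxc
  have hr' : r < u₁ := by
    by_contra! hle
    exact hn r v₂ hle hr le_rfl hv hxr
  exact hcn v₂ hv ⟨hx.row_line_of_mem hc' hxc fun j' _ h => hcn j' (h.trans hv),
    hx.col_line_of_mem hr' hxr fun i' _ h => hrn i' (h.trans hu)⟩

lemma hasAntichain_skel (hx : PartialPerm x) {k i j : ℕ} :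
    HasAntichain (skel x) (k + 1) i j ↔ HasAntichain x (k + 2) i j := by
  constructor
  · rintro ⟨u, v, h1, h2⟩
    have key : ∀ s, ∃ p : ℕ × ℕ, s < k + 2 → (p.1 < i ∧ p.2 < j ∧ x p.1 p.2) ∧
        (s < k + 1 → p.1 < u s ∧ v s ≤ p.2) ∧
        (∀ t, s = t + 1 → u t ≤ p.1 ∧ p.2 < v t) := by
      intro s
      by_cases hs : s < k + 2
      swap
      · exact ⟨(0, 0), fun h => absurd h hs⟩
      rcases Nat.eq_zero_or_pos s with rfl | hpos
      · have h0 := h1 0 (by omega)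
        obtain ⟨r, hr, hxr, -⟩ := hx.exists_of_col_line h0.2.2.2
        exact ⟨(r, v 0), fun _ => ⟨⟨by dsimp only; omega, h0.2.1, hxr⟩, fun _ => ⟨hr, le_rfl⟩,
          fun t ht => by omega⟩⟩
      · obtain ⟨t, rfl⟩ : ∃ t, s = t + 1 := ⟨s - 1, by omega⟩
        have ht := h1 t (by omega)
        by_cases hlast : t + 1 < k + 1
        · have ht' := h1 (t + 1) hlast
          obtain ⟨a, b, ha, ha', hb, hb', hab⟩ := hx.exists_mem_between (h2 t hlast).1
            (h2 t hlast).2 ht.2.2 ht'.2.2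
          refine ⟨(a, b), fun _ => ⟨⟨by dsimp only; omega, by dsimp only; omega, hab⟩,
            fun _ => ⟨ha', hb⟩, fun t' h' => ?_⟩⟩
          obtain rfl : t = t' := by omega
          exact ⟨ha, hb'⟩
        · obtain ⟨c, hc, hxc, -⟩ := hx.exists_of_row_line ht.2.2.1
          refine ⟨(u t, c), fun _ => ⟨⟨ht.1, by dsimp only; omega, hxc⟩,
            fun h => absurd h hlast, fun t' h' => ?_⟩⟩
          obtain rfl : t = t' := by omega
          exact ⟨le_rfl, hc⟩
    choose p hp using key
    refine ⟨fun s => (p s).1, fun s => (p s).2, fun s hs => (hp s hs).1, fun s hs => ?_⟩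
    have h3 := (hp s (by omega)).2.1 (by omega)
    have h4 := (hp (s + 1) hs).2.2 s rfl
    exact ⟨by dsimp only; omega, by dsimp only; omega⟩
  · rintro ⟨r, c, h1, h2⟩
    have key : ∀ s, ∃ p : ℕ × ℕ, s < k + 1 →
        r s < p.1 ∧ p.1 ≤ r (s + 1) ∧ c (s + 1) < p.2 ∧ p.2 ≤ c s ∧ skel x p.1 p.2 := by
      intro s
      by_cases hs : s < k + 1
      · obtain ⟨a, b, h⟩ := hx.exists_skel_between (h2 s (by omega)).1 (h2 s (by omega)).2
          (h1 s (by omega)).2.2 (h1 (s + 1) (by omega)).2.2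
        exact ⟨(a, b), fun _ => h⟩
      · exact ⟨(0, 0), fun h => absurd h hs⟩
    choose p hp using key
    refine ⟨fun s => (p s).1, fun s => (p s).2, fun s hs => ?_, fun s hs => ?_⟩
    · have h3 := hp s hs
      have h4 := h1 s (by omega)
      have h5 := h1 (s + 1) (by omega)
      exact ⟨by dsimp only; omega, by dsimp only; omega, h3.2.2.2.2⟩
    · have h3 := hp s (by omega)
      have h4 := hp (s + 1) hs
      exact ⟨by dsimp only; omega, by dsimp only; omega⟩

lemma hasAntichain_iff (hx : PartialPerm x) {k i j : ℕ} :
    HasAntichain x (k + 1) i j ↔ 0 < shape x i j k := by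
  induction k generalizing x with
  | zero =>
    refine Iff.trans ?_ (chainLen_pos_iff (x := x)).symm
    constructor
    · rintro ⟨r, c, h1, -⟩
      have := h1 0 (by omega)
      exact ⟨_, this.1, _, this.2⟩
    · rintro ⟨i', hi', j', hj', h⟩
      exact ⟨fun _ => i', fun _ => j', fun _ _ => ⟨hi', hj', h⟩, fun s hs => by omega⟩
  | succ k ih =>
    rw [← hx.hasAntichain_skel, ih hx.skeleton]
    rfl

end PartialPerm

lemma ConjFilling.hasChain_iff_hasAntichain {F x y : ℕ → ℕ → Prop} (h : ConjFilling F x y)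
    {k i j : ℕ} (hij : OnBoundary F i j) :
    HasChain y (k + 1) i j ↔ HasAntichain x (k + 1) i j := by
  rw [hasChain_iff, h.left.hasAntichain_iff]
  change k < shape y i j 0 ↔ _
  rw [h.shape_eq i j hij, (h.left.shape_isPartition i j).lt_conj_iff]

lemma IsFerrers.exists_onBoundary {F : ℕ → ℕ → Prop} (hF : IsFerrers F) {N : ℕ}
    (hN : ∀ i j, F i j → i < N ∧ j < N) {i j : ℕ} (h : F i j) :
    ∃ i', i + 1 ≤ i' ∧ OnBoundary F i' (j + 1) := by
  classical
  have hex : ∃ i', i + 1 ≤ i' ∧ ¬ F i' (j + 1) :=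
    ⟨i + 1 + N, by omega, fun h => by have := hN _ _ h; omega⟩
  have hspec := Nat.find_spec hex
  refine ⟨Nat.find hex, hspec.1, hspec.2, Or.inr (Or.inr ?_)⟩
  by_cases heq : Nat.find hex = i + 1
  · rw [heq]; exact h
  · have hm := Nat.find_min hex (m := Nat.find hex - 1) (by omega)
    have : F (Nat.find hex - 1) (j + 1) := by
      by_contra hf
      exact hm ⟨by omega, hf⟩
    exact hF _ _ _ _ this le_rfl (by omega)

/-- Conjugate fillings exchange the longest chains and antichains inside the board. -/
lemma ConjFilling.exists_chain_iff {F x y : ℕ → ℕ → Prop} (hF : IsFerrers F) {N : ℕ}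
    (hN : ∀ i j, F i j → i < N ∧ j < N) (h : ConjFilling F x y) (k : ℕ) :
    (∃ i j, F i j ∧ HasChain y (k + 1) (i + 1) (j + 1)) ↔
      ∃ i j, F i j ∧ HasAntichain x (k + 1) (i + 1) (j + 1) := by
  constructor
  · rintro ⟨i, j, hf, hc⟩
    obtain ⟨i', hi', hb⟩ := hF.exists_onBoundary hN hf
    have := (h.hasChain_iff_hasAntichain hb).1 (hc.mono hi' le_rfl)
    rcases hb.2 with h0 | h0 | h0
    · omega
    · omega
    · refine ⟨i' - 1, j, h0, ?_⟩
      rwa [Nat.sub_add_cancel (by omega)]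
  · rintro ⟨i, j, hf, hc⟩
    obtain ⟨i', hi', hb⟩ := hF.exists_onBoundary hN hf
    have := (h.hasChain_iff_hasAntichain hb).2 (hc.mono hi' le_rfl)
    rcases hb.2 with h0 | h0 | h0
    · omega
    · omega
    · refine ⟨i' - 1, j, h0, ?_⟩
      rwa [Nat.sub_add_cancel (by omega)]

/-! ### Occurrences of patterns in signed permutation matrices -/

lemma Fin.append_strictMono {α : Type*} [Preorder α] {a b : ℕ} {f : Fin a → α} {g : Fin b → α}
    (hf : StrictMono f) (hg : StrictMono g) (h : ∀ i j, f i < g j) :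
    StrictMono (Fin.append f g) := by
  intro i j
  induction i using Fin.addCases with
  | left i =>
    induction j using Fin.addCases with
    | left j => simpa using fun hij => hf ((Fin.strictMono_castAdd b).lt_iff_lt.1 hij)
    | right j => simpa using fun _ => h i j
  | right i =>
    induction j using Fin.addCases with
    | left j =>
      intro hlt
      simp only [Fin.lt_def, Fin.val_natAdd, Fin.val_castAdd] at hlt
      omega
    | right j => simpa using fun h => hg h

namespace IsSignedPermMatrix

variable {n : ℕ} {M : Matrix (Fin n) (Fin n) ℤ}

lemma col_eq (hM : IsSignedPermMatrix M) {i j j' : Fin n} (h : M i j ≠ 0) (h' : M i j' ≠ 0) :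
    j = j' :=
  (hM.2.1 i).unique h h'

lemma row_eq (hM : IsSignedPermMatrix M) {i i' j : Fin n} (h : M i j ≠ 0) (h' : M i' j ≠ 0) :
    i = i' :=
  (hM.2.2 j).unique h h'

/-- To exhibit a pattern it suffices to match its nonzero entries. -/
lemma submatrix_eq (hM : IsSignedPermMatrix M) {ι κ : Type*} {τ : ι → κ → ℤ} {r : ι → Fin n}
    {c : κ → Fin n} (hc : Function.Injective c) (hτ : ∀ a, ∃ b, τ a b ≠ 0)
    (h : ∀ a b, τ a b ≠ 0 → M (r a) (c b) = τ a b) (a : ι) (b : κ) : M (r a) (c b) = τ a b := by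
  by_cases h0 : τ a b = 0
  · rw [h0]
    by_contra hne
    obtain ⟨b', hb'⟩ := hτ a
    have h1 := h a b' hb'
    have := hc (hM.col_eq hne (h1 ▸ hb'))
    exact hb' (this ▸ h0)
  · exact h a b h0

end IsSignedPermMatrix

/-- The occurrence of `σ''` is determined by a `1` on or above the diagonal and an occurrence
of `σ` strictly to the north-east of it. -/
lemma containsPattern_doublePrimePat_iff {n k : ℕ} {M : Matrix (Fin n) (Fin n) ℤ}
    (hM : IsSignedPermMatrix M) (hs : M.IsSymm) {σ : Matrix (Fin k) (Fin k) ℤ}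
    (hr : ∀ a, ∃ b, σ a b ≠ 0) (hc : ∀ b, ∃ a, σ a b ≠ 0) :
    ContainsPattern M (doublePrimePat σ) ↔ ∃ r₀ c₀, M r₀ c₀ = 1 ∧ r₀ ≤ c₀ ∧
      ∃ r c : Fin k → Fin n, StrictMono r ∧ StrictMono c ∧ (∀ a, r a < r₀) ∧ (∀ b, c₀ < c b) ∧
        ∀ a b, M (r a) (c b) = σ a b := by
  constructor
  · rintro ⟨r, c, hrm, hcm, h⟩
    have h0 := h (Fin.natAdd k (Fin.castAdd k 0)) (Fin.natAdd k (Fin.castAdd k 0))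
    have h1 := fun a b => h (Fin.castAdd (1 + k) a) (Fin.natAdd k (Fin.natAdd 1 b))
    have h2 := fun a b => h (Fin.natAdd k (Fin.natAdd 1 a)) (Fin.castAdd (1 + k) b)
    simp only [doublePrimePat, Matrix.reindex_apply, Matrix.submatrix_apply,
      Equiv.symm_trans_apply, finSumFinEquiv_symm_apply_natAdd, finSumFinEquiv_symm_apply_castAdd,
      Equiv.sumCongr_symm, Equiv.sumCongr_apply, Sum.map_inl, Sum.map_inr,
      Matrix.fromBlocks_apply₁₁, Matrix.fromBlocks_apply₁₂, Matrix.fromBlocks_apply₂₁,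
      Matrix.fromBlocks_apply₂₂, Matrix.of_apply, Sum.elim_inr, Equiv.refl_symm,
      Equiv.refl_apply, Matrix.one_apply_eq, Matrix.transpose_apply] at h0 h1 h2
    rcases le_total (r (Fin.natAdd k (Fin.castAdd k 0))) (c (Fin.natAdd k (Fin.castAdd k 0)))
      with hle | hle
    · refine ⟨_, _, h0, hle, _, _, ?_, ?_, ?_, ?_, h1⟩
      · exact fun a b hab => hrm (by rw [Fin.lt_def] at hab ⊢; simpa using hab)
      · exact fun a b hab => hcm (by rw [Fin.lt_def] at hab ⊢; simpa using hab)
      · exact fun a => hrm (Fin.lt_def.2 (by simp))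
      · exact fun a => hcm (Fin.lt_def.2 (by simp))
    · refine ⟨_, _, (hs.apply _ _).trans h0, hle, _, _, ?_, ?_, ?_, ?_,
        fun a b => (hs.apply _ _).trans (h2 b a)⟩
      · exact fun a b hab => hcm (by rw [Fin.lt_def] at hab ⊢; simpa using hab)
      · exact fun a b hab => hrm (by rw [Fin.lt_def] at hab ⊢; simpa using hab)
      · exact fun a => hcm (Fin.lt_def.2 (by simp))
      · exact fun a => hrm (Fin.lt_def.2 (by simp))
  · rintro ⟨r₀, c₀, h0, hle, r, c, hrm, hcm, hr0, hc0, h⟩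
    have hR : StrictMono (Fin.append r (Fin.append (fun _ : Fin 1 => r₀) c)) := by
      refine Fin.append_strictMono hrm (Fin.append_strictMono (Subsingleton.strictMono _) hcm
        fun _ b => hle.trans_lt (hc0 b)) fun i j => ?_
      induction j using Fin.addCases with
      | left j => simpa using hr0 i
      | right j => simpa using (hr0 i).trans_le (hle.trans (hc0 j).le)
    have hC : StrictMono (Fin.append r (Fin.append (fun _ : Fin 1 => c₀) c)) := by
      refine Fin.append_strictMono hrm (Fin.append_strictMono (Subsingleton.strictMono _) hcm
        fun _ b => hc0 b) fun i j => ?_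
      induction j using Fin.addCases with
      | left j => simpa using (hr0 i).trans_le hle
      | right j => simpa using (hr0 i).trans_le (hle.trans (hc0 j).le)
    refine ⟨_, _, hR, hC, hM.submatrix_eq hC.injective (fun a => ?_) fun a b => ?_⟩
    · induction a using Fin.addCases with
      | left a =>
        obtain ⟨b, hb⟩ := hr a
        exact ⟨Fin.natAdd k (Fin.natAdd 1 b), by simpa [doublePrimePat] using hb⟩
      | right a =>
        induction a using Fin.addCases with
        | left a =>
          exact ⟨Fin.natAdd k (Fin.castAdd k a), by simp [doublePrimePat]⟩
        | right a =>
          obtain ⟨b, hb⟩ := hc a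
          exact ⟨Fin.castAdd (1 + k) b, by simpa [doublePrimePat] using hb⟩
    · induction a using Fin.addCases with
      | left a =>
        induction b using Fin.addCases with
        | left b => simp [doublePrimePat]
        | right b =>
          induction b using Fin.addCases with
          | left b => simp [doublePrimePat]
          | right b => simp [doublePrimePat, h]
      | right a =>
        induction a using Fin.addCases with
        | left a =>
          induction b using Fin.addCases with
          | left b => simp [doublePrimePat]
          | right b =>
            induction b using Fin.addCases with
            | left b => simp [doublePrimePat, h0, Subsingleton.elim a b]
            | right b => simp [doublePrimePat]
        | right a =>
          induction b using Fin.addCases with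
          | left b => simpa [doublePrimePat] using fun _ => (hs.apply _ _).trans (h b a)
          | right b =>
            induction b using Fin.addCases with
            | left b => simp [doublePrimePat]
            | right b => simp [doublePrimePat]

/-- Occurrences of `[[0, A], [χ, 0]]` split into an occurrence of `A` and one of `χ` to its
south-west. -/
lemma occurrence_antiBlock2_iff {n k m : ℕ} {M : Matrix (Fin n) (Fin n) ℤ}
    (hM : IsSignedPermMatrix M) {A : Matrix (Fin k) (Fin k) ℤ} {χ : Matrix (Fin m) (Fin m) ℤ}
    (hA : ∀ a, ∃ b, A a b ≠ 0) (hχ : ∀ a, ∃ b, χ a b ≠ 0) {r₀ c₀ : Fin n} :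
    (∃ r c : Fin (k + m) → Fin n, StrictMono r ∧ StrictMono c ∧ (∀ a, r a < r₀) ∧
      (∀ b, c₀ < c b) ∧ ∀ a b, M (r a) (c b) = antiBlock2 A χ a b) ↔
    ∃ r c : Fin k → Fin n, ∃ r' c' : Fin m → Fin n, StrictMono r ∧ StrictMono c ∧
      StrictMono r' ∧ StrictMono c' ∧ (∀ a, r a < r₀) ∧ (∀ b, c₀ < c b) ∧ (∀ a, r' a < r₀) ∧
      (∀ b, c₀ < c' b) ∧ (∀ a b, r a < r' b) ∧ (∀ a b, c' a < c b) ∧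
      (∀ a b, M (r a) (c b) = A a b) ∧ ∀ a b, M (r' a) (c' b) = χ a b := by
  constructor
  · rintro ⟨r, c, hrm, hcm, hr0, hc0, h⟩
    refine ⟨fun a => r (Fin.castAdd m a), fun b => c (Fin.cast (Nat.add_comm m k) (Fin.natAdd m b)),
      fun a => r (Fin.natAdd k a), fun b => c (Fin.cast (Nat.add_comm m k) (Fin.castAdd k b)),
      fun a b hab => hrm (by rw [Fin.lt_def] at hab ⊢; simpa using hab),
      fun a b hab => hcm (by rw [Fin.lt_def] at hab ⊢; simpa using hab),
      fun a b hab => hrm (by rw [Fin.lt_def] at hab ⊢; simpa using hab),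
      fun a b hab => hcm (by rw [Fin.lt_def] at hab ⊢; simpa using hab),
      fun a => hr0 _, fun a => hc0 _, fun a => hr0 _, fun a => hc0 _,
      fun a b => hrm (Fin.lt_def.2 (by simp; omega)), fun a b => hcm (Fin.lt_def.2 (by simp; omega)),
      fun a b => ?_, fun a b => ?_⟩
    · rw [h]; simp [antiBlock2]
    · rw [h]; simp [antiBlock2]
  · rintro ⟨r, c, r', c', hrm, hcm, hrm', hcm', hr0, hc0, hr0', hc0', hrr, hcc, h, h'⟩
    have hC : StrictMono (fun b => Fin.append c' c (Fin.cast (Nat.add_comm k m) b)) :=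
      (Fin.append_strictMono hcm' hcm hcc).comp fun a b hab => by
        rw [Fin.lt_def] at hab ⊢; simpa using hab
    refine ⟨Fin.append r r', _, Fin.append_strictMono hrm hrm' hrr, hC, fun a => ?_, fun b => ?_,
      hM.submatrix_eq hC.injective (fun a => ?_) fun a b => ?_⟩
    · induction a using Fin.addCases with
      | left a => simpa using hr0 a
      | right a => simpa using hr0' a
    · obtain ⟨b, rfl⟩ : ∃ b', b = Fin.cast (Nat.add_comm m k) b' := ⟨Fin.cast (Nat.add_comm k m) b, rfl⟩
      induction b using Fin.addCases with
      | left a => simpa using hc0' a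
      | right a => simpa using hc0 a
    · induction a using Fin.addCases with
      | left a =>
        obtain ⟨b, hb⟩ := hA a
        exact ⟨Fin.cast (Nat.add_comm m k) (Fin.natAdd m b), by simpa [antiBlock2] using hb⟩
      | right a =>
        obtain ⟨b, hb⟩ := hχ a
        exact ⟨Fin.cast (Nat.add_comm m k) (Fin.castAdd k b), by simpa [antiBlock2] using hb⟩
    · obtain ⟨b, rfl⟩ : ∃ b', b = Fin.cast (Nat.add_comm m k) b' := ⟨Fin.cast (Nat.add_comm k m) b, rfl⟩
      induction a using Fin.addCases with
      | left a =>
        induction b using Fin.addCases with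
        | left b => simp [antiBlock2]
        | right b => simp [antiBlock2, h]
      | right a =>
        induction b using Fin.addCases with
        | left b => simp [antiBlock2, h']
        | right b => simp [antiBlock2]

/-- The cells `(i, j)` with an occurrence of `χ` followed by a `1` on or above the diagonal
strictly to their south-west. -/
def board {n m : ℕ} (M : Matrix (Fin n) (Fin n) ℤ) (χ : Matrix (Fin m) (Fin m) ℤ)
    (i j : Fin n) : Prop :=
  ∃ r₀ c₀, M r₀ c₀ = 1 ∧ r₀ ≤ c₀ ∧ i < r₀ ∧ c₀ < j ∧ ∃ r c : Fin m → Fin n,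
    StrictMono r ∧ StrictMono c ∧ (∀ a, i < r a ∧ r a < r₀) ∧ (∀ b, c₀ < c b ∧ c b < j) ∧
      ∀ a b, M (r a) (c b) = χ a b

section Board

variable {n m : ℕ} {M : Matrix (Fin n) (Fin n) ℤ} {χ : Matrix (Fin m) (Fin m) ℤ}

lemma board.lt {i j : Fin n} (h : board M χ i j) : i < j := by
  obtain ⟨r₀, c₀, -, h1, h2, h3, -⟩ := h
  exact h2.trans_le (h1.trans h3.le)

lemma board.mono {i j i' j' : Fin n} (h : board M χ i j) (hi : i' ≤ i) (hj : j ≤ j') :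
    board M χ i' j' := by
  obtain ⟨r₀, c₀, h0, h1, h2, h3, r, c, hr, hc, hr0, hc0, h⟩ := h
  exact ⟨r₀, c₀, h0, h1, hi.trans_lt h2, h3.trans_le hj, r, c, hr, hc,
    fun a => ⟨hi.trans_lt (hr0 a).1, (hr0 a).2⟩, fun b => ⟨(hc0 b).1, (hc0 b).2.trans_le hj⟩, h⟩

/-- The board only depends on the entries outside of it and of its transpose. -/
lemma board_congr {M' : Matrix (Fin n) (Fin n) ℤ}
    (h : ∀ i j, ¬ board M χ i j → ¬ board M χ j i → M' i j = M i j) :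
    board M' χ = board M χ := by
  have hagree : ∀ {i j}, i < j → ¬ board M χ i j → M' i j = M i j :=
    fun hij hB => h _ _ hB fun hB' => hij.not_gt hB'.lt
  have hle : ∀ {i j}, board M' χ i j → board M χ i j := by
    intro i j hB'
    by_contra hB
    obtain ⟨r₀, c₀, h0, h1, h2, h3, r, c, hr, hc, hr0, hc0, hocc⟩ := hB'
    have off : ∀ {a b}, i < a → b < j → ¬ board M χ a b := fun ha hb hab =>
      hB (hab.mono ha.le hb.le)
    refine hB ⟨r₀, c₀, ?_, h1, h2, h3, r, c, hr, hc, hr0, hc0, fun a b => ?_⟩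
    · rw [← h0]
      exact (h _ _ (off h2 h3) fun hB' => h1.not_gt hB'.lt).symm
    · rw [← hocc]
      exact (hagree ((hr0 a).2.trans_le (h1.trans (hc0 b).1.le)) (off (hr0 a).1 (hc0 b).2)).symm
  have hge : ∀ N (i j : Fin n), n - i + j < N → board M χ i j → board M' χ i j := by
    intro N
    induction N with
    | zero => intro i j hN; omega
    | succ N ih =>
      intro i j hN hB
      obtain ⟨r₀, c₀, h0, h1, h2, h3, r, c, hr, hc, hr0, hc0, hocc⟩ := hB
      by_cases hex : ∃ a b, i < a ∧ b < j ∧ board M χ a b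
      · obtain ⟨a, b, ha, hb, hab⟩ := hex
        exact (ih a b (by omega) hab).mono ha.le hb.le
      push Not at hex
      refine ⟨r₀, c₀, ?_, h1, h2, h3, r, c, hr, hc, hr0, hc0, fun a b => ?_⟩
      · rw [← h0]
        exact h _ _ (hex _ _ h2 h3) fun hB' => h1.not_gt hB'.lt
      · rw [← hocc]
        exact hagree ((hr0 a).2.trans_le (h1.trans (hc0 b).1.le)) (hex _ _ (hr0 a).1 (hc0 b).2)
  ext i j
  exact ⟨hle, hge _ i j (Nat.lt_succ_self _)⟩

/-- A relation on `Fin n`, with columns reversed, as a relation on `ℕ`. -/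
def natRev (P : Fin n → Fin n → Prop) (i j : ℕ) : Prop :=
  ∃ (hi : i < n) (hj : j < n), P ⟨i, hi⟩ (Fin.rev ⟨j, hj⟩)

lemma natRev_val {P : Fin n → Fin n → Prop} {i j : Fin n} :
    natRev P i (Fin.rev j : Fin n) ↔ P i j := by
  have hrev : Fin.rev ⟨(Fin.rev j : Fin n), (Fin.rev j).2⟩ = j := Fin.rev_rev j
  constructor
  · rintro ⟨hi, hj, h⟩
    rwa [hrev] at h
  · intro h
    exact ⟨i.2, (Fin.rev j).2, hrev.symm ▸ h⟩

lemma natRev.lt {P : Fin n → Fin n → Prop} {i j : ℕ} (h : natRev P i j) : i < n ∧ j < n :=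
  ⟨h.1, h.2.1⟩

lemma isFerrers_natRev_board : IsFerrers (natRev (board M χ)) := by
  rintro i j i' j' ⟨hi, hj, h⟩ hi' hj'
  exact ⟨by omega, by omega, h.mono hi' (Fin.rev_le_rev.2 hj')⟩

lemma IsSignedPermMatrix.partialPerm (hM : IsSignedPermMatrix M) (P : Fin n → Fin n → Prop) :
    PartialPerm (natRev fun i j => P i j ∧ M i j = 1) := by
  constructor
  · rintro i j j' ⟨hi, hj, -, h⟩ ⟨_, hj', -, h'⟩
    have := hM.col_eq (h ▸ one_ne_zero) (h' ▸ one_ne_zero)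
    simpa using this
  · rintro i i' j ⟨hi, hj, -, h⟩ ⟨hi', _, -, h'⟩
    have := hM.row_eq (h ▸ one_ne_zero) (h' ▸ one_ne_zero)
    simpa using this

lemma containsPattern_iff_board {k : ℕ} (hM : IsSignedPermMatrix M) (hs : M.IsSymm)
    (hχ : IsSignedPermMatrix χ) {A : Matrix (Fin (k + 1)) (Fin (k + 1)) ℤ}
    (hA : ∀ a, ∃ b, A a b ≠ 0) (hA' : ∀ b, ∃ a, A a b ≠ 0) :
    ContainsPattern M (doublePrimePat (antiBlock2 A χ)) ↔
      ∃ r c : Fin (k + 1) → Fin n, StrictMono r ∧ StrictMono c ∧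
        board M χ (r (Fin.last k)) (c 0) ∧ ∀ a b, M (r a) (c b) = A a b := by
  have hχr : ∀ a, ∃ b, χ a b ≠ 0 := fun a => (hχ.2.1 a).exists
  have hχc : ∀ b, ∃ a, χ a b ≠ 0 := fun b => (hχ.2.2 b).exists
  rw [containsPattern_doublePrimePat_iff hM hs]
  · constructor
    · rintro ⟨r₀, c₀, h0, hle, h⟩
      obtain ⟨r, c, r', c', hr, hc, hr', hc', hr0, hc0, hr0', hc0', hrr, hcc, h, h'⟩ :=
        (occurrence_antiBlock2_iff hM hA hχr).1 h
      exact ⟨r, c, hr, hc, ⟨r₀, c₀, h0, hle, hr0 _, hc0 _, r', c', hr', hc',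
        fun a => ⟨hrr _ _, hr0' _⟩, fun b => ⟨hc0' _, hcc _ _⟩, h'⟩, h⟩
    · rintro ⟨r, c, hr, hc, ⟨r₀, c₀, h0, hle, h1, h2, r', c', hr', hc', hr0, hc0, h'⟩, h⟩
      have hrl : ∀ a, r a ≤ r (Fin.last k) := fun a => hr.monotone (Fin.le_last a)
      have hcl : ∀ a, c 0 ≤ c a := fun a => hc.monotone (Fin.zero_le a)
      exact ⟨r₀, c₀, h0, hle, (occurrence_antiBlock2_iff hM hA hχr).2 ⟨r, c, r', c', hr, hc, hr',
        hc', fun a => (hrl a).trans_lt h1, fun b => h2.trans_le (hcl b), fun a => (hr0 a).2,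
        fun b => (hc0 b).1, fun a b => (hrl a).trans_lt (hr0 b).1,
        fun a b => (hc0 a).2.trans_le (hcl b), h, h'⟩⟩
  · intro a
    induction a using Fin.addCases with
    | left a =>
      obtain ⟨b, hb⟩ := hA a
      exact ⟨Fin.cast (Nat.add_comm m (k + 1)) (Fin.natAdd m b), by simpa [antiBlock2] using hb⟩
    | right a =>
      obtain ⟨b, hb⟩ := hχr a
      exact ⟨Fin.cast (Nat.add_comm m (k + 1)) (Fin.castAdd (k + 1) b),
        by simpa [antiBlock2] using hb⟩
  · intro b
    obtain ⟨b, rfl⟩ : ∃ b', b = Fin.cast (Nat.add_comm m (k + 1)) b' :=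
      ⟨Fin.cast (Nat.add_comm (k + 1) m) b, rfl⟩
    induction b using Fin.addCases with
    | left b =>
      obtain ⟨a, ha⟩ := hχc b
      exact ⟨Fin.natAdd (k + 1) a, by simpa [antiBlock2] using ha⟩
    | right b =>
      obtain ⟨a, ha⟩ := hA' b
      exact ⟨Fin.castAdd m a, by simpa [antiBlock2] using ha⟩

lemma betaMat_apply {k : ℕ} (a b : Fin k) : betaMat k a b = if b = Fin.rev a then 1 else 0 := by
  simp only [betaMat, Matrix.of_apply, Fin.ext_iff, Fin.val_rev]
  exact if_congr (by omega) rfl rfl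

lemma containsPattern_one_iff {k : ℕ} (hM : IsSignedPermMatrix M) (hs : M.IsSymm)
    (hχ : IsSignedPermMatrix χ) :
    ContainsPattern M (doublePrimePat (antiBlock2 (1 : Matrix (Fin (k + 1)) (Fin (k + 1)) ℤ) χ)) ↔
      ∃ i j, natRev (board M χ) i j ∧
        HasAntichain (natRev fun i j => board M χ i j ∧ M i j = 1) (k + 1) (i + 1) (j + 1) := by
  have hA : ∀ a, ∃ b, (1 : Matrix (Fin (k + 1)) (Fin (k + 1)) ℤ) a b ≠ 0 := fun a => ⟨a, by simp⟩
  rw [containsPattern_iff_board hM hs hχ hA fun b => ⟨b, by simp⟩]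
  constructor
  · rintro ⟨r, c, hr, hc, hB, h⟩
    refine ⟨r (Fin.last k), (Fin.rev (c 0) : Fin n), natRev_val.2 hB,
      fun s => r ⟨min s k, by omega⟩, fun s => (Fin.rev (c ⟨min s k, by omega⟩) : Fin n),
      fun s hs => ?_, fun s hs => ?_⟩
    · have h1 := hr.monotone (Fin.le_last (⟨min s k, by omega⟩ : Fin (k + 1)))
      have h2 := hc.monotone (Fin.zero_le (⟨min s k, by omega⟩ : Fin (k + 1)))
      exact ⟨Nat.lt_succ_of_le h1, Nat.lt_succ_of_le (Fin.rev_le_rev.2 h2),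
        natRev_val.2 ⟨hB.mono h1 h2, by rw [h, Matrix.one_apply_eq]⟩⟩
    · have hlt : (⟨min s k, by omega⟩ : Fin (k + 1)) < ⟨min (s + 1) k, by omega⟩ := by
        rw [Fin.lt_def]; simp only; omega
      exact ⟨hr hlt, Fin.rev_lt_rev.2 (hc hlt)⟩
  · rintro ⟨i, j, hF, r, c, h1, h2⟩
    have hx := fun a : Fin (k + 1) => (h1 a a.2).2.2
    have hc : StrictMono fun a : Fin (k + 1) => Fin.rev ⟨c a, (hx a).2.1⟩ :=
      Fin.strictMono_iff_lt_succ.2 fun a => Fin.rev_lt_rev.2 (h2 a (by omega)).2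
    refine ⟨fun a => ⟨r a, (hx a).1⟩, _, Fin.strictMono_iff_lt_succ.2 fun a => (h2 a (by omega)).1,
      hc, ?_, hM.submatrix_eq hc.injective hA fun a b hab => ?_⟩
    · obtain ⟨hi, hj, hF⟩ := hF
      exact hF.mono (Nat.le_of_lt_succ (h1 _ (Fin.last k).2).1)
        (Fin.rev_le_rev.2 (Nat.le_of_lt_succ (h1 _ (0 : Fin (k + 1)).2).2.1))
    · rw [Matrix.one_apply, ne_eq, ite_eq_right_iff, Classical.not_imp] at hab
      obtain ⟨rfl, -⟩ := hab
      rw [Matrix.one_apply_eq]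
      exact (hx a).2.2.2

lemma containsPattern_betaMat_iff {k : ℕ} (hM : IsSignedPermMatrix M) (hs : M.IsSymm)
    (hχ : IsSignedPermMatrix χ) :
    ContainsPattern M (doublePrimePat (antiBlock2 (betaMat (k + 1)) χ)) ↔
      ∃ i j, natRev (board M χ) i j ∧
        HasChain (natRev fun i j => board M χ i j ∧ M i j = 1) (k + 1) (i + 1) (j + 1) := by
  have hA : ∀ a, ∃ b, betaMat (k + 1) a b ≠ 0 := fun a => ⟨Fin.rev a, by simp [betaMat_apply]⟩
  rw [containsPattern_iff_board hM hs hχ hA fun b => ⟨Fin.rev b, by simp [betaMat_apply]⟩]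
  constructor
  · rintro ⟨r, c, hr, hc, hB, h⟩
    refine ⟨r (Fin.last k), (Fin.rev (c 0) : Fin n), natRev_val.2 hB,
      fun s => r ⟨min s k, by omega⟩, fun s => (Fin.rev (c (Fin.rev ⟨min s k, by omega⟩)) : Fin n),
      fun s hs => ?_, fun s hs => ?_⟩
    · have h1 := hr.monotone (Fin.le_last (⟨min s k, by omega⟩ : Fin (k + 1)))
      have h2 := hc.monotone (Fin.zero_le (Fin.rev ⟨min s k, by omega⟩ : Fin (k + 1)))
      exact ⟨Nat.lt_succ_of_le h1, Nat.lt_succ_of_le (Fin.rev_le_rev.2 h2),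
        natRev_val.2 ⟨hB.mono h1 h2, by rw [h, betaMat_apply, if_pos rfl]⟩⟩
    · have hlt : (⟨min s k, by omega⟩ : Fin (k + 1)) < ⟨min (s + 1) k, by omega⟩ := by
        rw [Fin.lt_def]; simp only; omega
      exact ⟨hr hlt, Fin.rev_lt_rev.2 (hc (Fin.rev_lt_rev.2 hlt))⟩
  · rintro ⟨i, j, hF, r, c, h1, h2⟩
    have hx := fun a : Fin (k + 1) => (h1 a a.2).2.2
    have hc' : StrictMono fun a : Fin (k + 1) => (⟨c a, (hx a).2.1⟩ : Fin n) :=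
      Fin.strictMono_iff_lt_succ.2 fun a => (h2 a (by omega)).2
    have hc : StrictMono fun a : Fin (k + 1) =>
        Fin.rev ⟨c (Fin.rev a : Fin (k + 1)), (hx (Fin.rev a)).2.1⟩ :=
      fun a b hab => Fin.rev_lt_rev.2 (hc' (Fin.rev_lt_rev.2 hab))
    refine ⟨fun a => ⟨r a, (hx a).1⟩, _, Fin.strictMono_iff_lt_succ.2 fun a => (h2 a (by omega)).1,
      hc, ?_, hM.submatrix_eq hc.injective hA fun a b hab => ?_⟩
    · obtain ⟨hi, hj, hF⟩ := hF
      exact hF.mono (Nat.le_of_lt_succ (h1 _ (Fin.last k).2).1)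
        (Fin.rev_le_rev.2 (Nat.le_of_lt_succ (h1 _ (Fin.rev 0 : Fin (k + 1)).2).2.1))
    · rw [betaMat_apply, ne_eq, ite_eq_right_iff, Classical.not_imp] at hab
      obtain ⟨rfl, -⟩ := hab
      rw [betaMat_apply, if_pos rfl]
      simp only [Fin.rev_rev]
      exact (hx a).2.2.2

end Board

/-! ### Conjugate signed involutions -/

/-- The `1`s of `M` inside its board. -/
def boardOnes {n m : ℕ} (M : Matrix (Fin n) (Fin n) ℤ) (χ : Matrix (Fin m) (Fin m) ℤ) :
    ℕ → ℕ → Prop :=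
  natRev fun i j => board M χ i j ∧ M i j = 1

/-- `M` and `M'` are signed involutions with the same board that only differ in the `1`s on the
board and on its transpose, and these form conjugate fillings. -/
structure ConjInvolution {n m : ℕ} (χ : Matrix (Fin m) (Fin m) ℤ)
    (M M' : Matrix (Fin n) (Fin n) ℤ) : Prop where
  left : IsSignedPermMatrix M
  right : IsSignedPermMatrix M'
  left_symm : M.IsSymm
  right_symm : M'.IsSymm
  board_eq : board M' χ = board M χ
  off : ∀ i j, ¬ board M χ i j → ¬ board M χ j i → M' i j = M i j
  neg : ∀ i j, board M χ i j → (M' i j = -1 ↔ M i j = -1)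
  conj : ConjFilling (natRev (board M χ)) (boardOnes M χ) (boardOnes M' χ)

section Involution

variable {n m : ℕ} {M M' : Matrix (Fin n) (Fin n) ℤ} {χ : Matrix (Fin m) (Fin m) ℤ}

lemma ConjInvolution.symm (h : ConjInvolution χ M M') : ConjInvolution χ M' M where
  left := h.right
  right := h.left
  left_symm := h.right_symm
  right_symm := h.left_symm
  board_eq := h.board_eq.symm
  off i j := by
    rw [h.board_eq]
    exact fun h1 h2 => (h.off i j h1 h2).symm
  neg i j := by
    rw [h.board_eq]
    exact fun h1 => (h.neg i j h1).symm
  conj := by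
    rw [h.board_eq]
    exact h.conj.symm

lemma ConjInvolution.unique {M'' : Matrix (Fin n) (Fin n) ℤ} (h : ConjInvolution χ M M')
    (h' : ConjInvolution χ M M'') : M' = M'' := by
  have hones := h.conj.unique isFerrers_natRev_board (fun _ _ => natRev.lt) h'.conj
  have key : ∀ i j, board M χ i j → M' i j = M'' i j := by
    intro i j hB
    have hone : M' i j = 1 ↔ M'' i j = 1 := by
      have := congrFun (congrFun hones i) (Fin.rev j : Fin n)
      rw [boardOnes, boardOnes, natRev_val, natRev_val, h.board_eq, h'.board_eq] at this
      simpa [hB] using this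
    have hneg := (h.neg i j hB).trans (h'.neg i j hB).symm
    have h1 := h.right.1 i j
    have h2 := h'.right.1 i j
    omega
  ext i j
  by_cases h1 : board M χ i j
  · exact key i j h1
  by_cases h2 : board M χ j i
  · rw [← h.right_symm.apply, ← h'.right_symm.apply]
    exact key j i h2
  · rw [h.off i j h1 h2, h'.off i j h1 h2]

lemma ConjInvolution.containsPattern_iff (h : ConjInvolution χ M M') (hχ : IsSignedPermMatrix χ)
    (k : ℕ) :
    ContainsPattern M' (doublePrimePat (antiBlock2 (betaMat (k + 1)) χ)) ↔
      ContainsPattern M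
        (doublePrimePat (antiBlock2 (1 : Matrix (Fin (k + 1)) (Fin (k + 1)) ℤ) χ)) := by
  rw [containsPattern_betaMat_iff h.right h.right_symm hχ,
    containsPattern_one_iff h.left h.left_symm hχ, h.board_eq]
  have := h.conj.exists_chain_iff isFerrers_natRev_board (fun _ _ => natRev.lt) k
  rwa [boardOnes, boardOnes, h.board_eq] at this

open Classical in
/-- Replace the `1`s of `M` on `B` and on its transpose by `Y` and its transpose. -/
noncomputable def replaceOnes (M : Matrix (Fin n) (Fin n) ℤ) (B Y : Fin n → Fin n → Prop) :
    Matrix (Fin n) (Fin n) ℤ :=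
  Matrix.of fun i j =>
    if Y i j ∨ Y j i then 1 else if (B i j ∨ B j i) ∧ M i j = 1 then 0 else M i j

lemma isSymm_replaceOnes (hs : M.IsSymm) (B Y : Fin n → Fin n → Prop) :
    (replaceOnes M B Y).IsSymm := by
  classical
  ext i j
  simp only [Matrix.transpose_apply, replaceOnes, Matrix.of_apply]
  rw [hs.apply i j]
  exact if_congr or_comm rfl (if_congr (and_congr_left' or_comm) rfl rfl)

lemma isSignedPermMatrix_replaceOnes (hM : IsSignedPermMatrix M) (hs : M.IsSymm)
    {B Y : Fin n → Fin n → Prop} (hB : ∀ i j, B i j → ¬ B j i)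
    (hYr : ∀ i j j', Y i j → Y i j' → j = j') (hYc : ∀ i i' j, Y i j → Y i' j → i = i')
    (hr : ∀ i, (∃ j, B i j ∧ M i j = 1) ↔ ∃ j, Y i j)
    (hc : ∀ j, (∃ i, B i j ∧ M i j = 1) ↔ ∃ i, Y i j) :
    IsSignedPermMatrix (replaceOnes M B Y) := by
  have hrow : ∀ i, ∃! j, replaceOnes M B Y i j ≠ 0 := by
    intro i
    have hcases : ∀ j, replaceOnes M B Y i j ≠ 0 → (Y i j ∧ ∃ j', B i j' ∧ M i j' = 1) ∨
        (Y j i ∧ ∃ j', B j' i ∧ M i j' = 1) ∨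
        (M i j ≠ 0 ∧ ¬ (B i j ∧ M i j = 1) ∧ ¬ (B j i ∧ M i j = 1)) := by
      intro j hne
      by_cases h1 : Y i j
      · exact Or.inl ⟨h1, (hr i).2 ⟨j, h1⟩⟩
      by_cases h2 : Y j i
      · obtain ⟨j', h3, h4⟩ := (hc i).2 ⟨j, h2⟩
        exact Or.inr (Or.inl ⟨h2, j', h3, (hs.apply _ _).trans h4⟩)
      simp only [replaceOnes, Matrix.of_apply, h1, h2, or_self, if_false] at hne
      split_ifs at hne with h3
      · exact absurd rfl hne
      · exact Or.inr (Or.inr ⟨hne, fun h => h3 ⟨Or.inl h.1, h.2⟩, fun h => h3 ⟨Or.inr h.1, h.2⟩⟩)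
    have hone : ∀ {j}, M i j = 1 → M i j ≠ 0 := fun h => h ▸ one_ne_zero
    refine existsUnique_of_exists_of_unique ?_ fun j j' h h' => ?_
    · obtain ⟨j, hj⟩ := (hM.2.1 i).exists
      by_cases h1 : M i j = 1 ∧ B i j
      · obtain ⟨j', hj'⟩ := (hr i).1 ⟨j, h1.2, h1.1⟩
        exact ⟨j', by simp [replaceOnes, hj']⟩
      by_cases h2 : M i j = 1 ∧ B j i
      · obtain ⟨j', hj'⟩ := (hc i).1 ⟨j, h2.2, (hs.apply _ _).trans h2.1⟩
        exact ⟨j', by simp [replaceOnes, hj']⟩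
      refine ⟨j, ?_⟩
      simp only [replaceOnes, Matrix.of_apply]
      split_ifs with h3 h4
      · exact one_ne_zero
      · tauto
      · exact hj
    · rcases hcases j h with ⟨h1, a, ha, ha'⟩ | ⟨h1, a, ha, ha'⟩ | ⟨h1, h2, h3⟩ <;>
        rcases hcases j' h' with ⟨h1', b, hb, hb'⟩ | ⟨h1', b, hb, hb'⟩ | ⟨h1', h2', h3'⟩
      · exact hYr _ _ _ h1 h1'
      · obtain rfl := hM.col_eq (hone ha') (hone hb')
        exact absurd hb (hB _ _ ha)
      · obtain rfl := hM.col_eq (hone ha') h1'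
        exact absurd ⟨ha, ha'⟩ h2'
      · obtain rfl := hM.col_eq (hone ha') (hone hb')
        exact absurd ha (hB _ _ hb)
      · exact hYc _ _ _ h1 h1'
      · obtain rfl := hM.col_eq (hone ha') h1'
        exact absurd ⟨ha, ha'⟩ h3'
      · obtain rfl := hM.col_eq (hone hb') h1
        exact absurd ⟨hb, hb'⟩ h2
      · obtain rfl := hM.col_eq (hone hb') h1
        exact absurd ⟨hb, hb'⟩ h3
      · exact hM.col_eq h1 h1'
  refine ⟨fun i j => ?_, hrow, fun j => ?_⟩
  · simp only [replaceOnes, Matrix.of_apply]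
    split_ifs
    · exact Or.inr (Or.inl rfl)
    · exact Or.inl rfl
    · exact hM.1 i j
  · simpa only [(isSymm_replaceOnes hs B Y).apply j] using hrow j

lemma exists_conjInvolution (hM : IsSignedPermMatrix M) (hs : M.IsSymm)
    (χ : Matrix (Fin m) (Fin m) ℤ) : ∃ M', ConjInvolution χ M M' := by
  have hF : IsFerrers (natRev (board M χ)) := isFerrers_natRev_board
  have hN : ∀ i j, natRev (board M χ) i j → i < n ∧ j < n := fun _ _ => natRev.lt
  obtain ⟨y, hy⟩ := exists_conjFilling hF hN (hM.partialPerm (board M χ))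
    fun i j ⟨hi, hj, h⟩ => ⟨hi, hj, h.1⟩
  set Y : Fin n → Fin n → Prop := fun i j => y i (Fin.rev j : Fin n) with hYdef
  have hyY : natRev Y = y := by
    ext i j
    constructor
    · rintro ⟨hi, hj, h⟩
      simpa only [hYdef, Fin.rev_rev] using h
    · intro h
      obtain ⟨hi, hj⟩ := hN _ _ (hy.right_subset _ _ h)
      exact ⟨hi, hj, by simpa only [hYdef, Fin.rev_rev] using h⟩
  have hYB : ∀ i j, Y i j → board M χ i j := fun i j h => natRev_val.1 (hy.right_subset _ _ h)
  have hB : ∀ i j, board M χ i j → ¬ board M χ j i := fun i j h h' => h.lt.not_gt h'.lt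
  have hr : ∀ i, (∃ j, board M χ i j ∧ M i j = 1) ↔ ∃ j, Y i j := by
    intro i
    have := hy.row_iff hF hN i
    rw [← hyY] at this
    constructor
    · rintro ⟨j, hj⟩
      obtain ⟨j', hi', hj', h⟩ := this.1 ⟨_, natRev_val.2 hj⟩
      exact ⟨_, h⟩
    · rintro ⟨j, hj⟩
      obtain ⟨j', hi', hj', h⟩ := this.2 ⟨_, natRev_val.2 hj⟩
      exact ⟨_, h⟩
  have hc : ∀ j, (∃ i, board M χ i j ∧ M i j = 1) ↔ ∃ i, Y i j := by
    intro j
    have := hy.col_iff hF hN (Fin.rev j : Fin n)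
    rw [← hyY] at this
    have hrev : Fin.rev ⟨(Fin.rev j : Fin n), (Fin.rev j).2⟩ = j := Fin.rev_rev j
    constructor
    · rintro ⟨i, hi⟩
      obtain ⟨i', hi', hj', h⟩ := this.1 ⟨_, natRev_val.2 hi⟩
      exact ⟨_, hrev ▸ h⟩
    · rintro ⟨i, hi⟩
      obtain ⟨i', hi', hj', h⟩ := this.2 ⟨_, natRev_val.2 hi⟩
      exact ⟨_, hrev ▸ h⟩
  have hoff : ∀ i j, ¬ board M χ i j → ¬ board M χ j i →
      replaceOnes M (board M χ) Y i j = M i j := fun i j h1 h2 => by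
    simp [replaceOnes, h1, h2, mt (hYB _ _) h1, mt (hYB _ _) h2]
  have hboard : board (replaceOnes M (board M χ) Y) χ = board M χ := board_congr hoff
  have hones : boardOnes (replaceOnes M (board M χ) Y) χ = y := by
    rw [boardOnes, hboard, ← hyY]
    congr 1
    ext i j
    constructor
    · rintro ⟨h1, h2⟩
      by_contra hY
      simp only [replaceOnes, Matrix.of_apply, hY, h1, mt (hYB _ _) (hB _ _ h1), or_self,
        if_false, true_or, true_and] at h2
      split_ifs at h2 with h3
      · exact zero_ne_one h2
      · exact h3 h2
    · intro h
      exact ⟨hYB _ _ h, by simp [replaceOnes, h]⟩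
  refine ⟨_, hM, isSignedPermMatrix_replaceOnes hM hs hB (fun i j j' h h' => ?_)
    (fun i i' j h h' => ?_) hr hc, hs, isSymm_replaceOnes hs _ _, hboard, hoff, fun i j h => ?_, ?_⟩
  · exact Fin.rev_injective (Fin.ext (hy.right.1 _ _ _ h h'))
  · exact Fin.ext (hy.right.2 _ _ _ h h')
  · by_cases hY : Y i j
    · obtain ⟨j', -, hj'⟩ := (hr i).2 ⟨j, hY⟩
      have hne : M i j ≠ -1 := fun hneg => by
        have := hM.col_eq (j := j) (j' := j') (by rw [hneg]; decide) (by rw [hj']; decide)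
        subst this
        omega
      simp [replaceOnes, hY, hne]
    · simp only [replaceOnes, Matrix.of_apply, hY, mt (hYB _ _) (hB _ _ h), or_self, if_false]
      split_ifs with h1
      · simp [h1.2]
      · rfl
  · rw [hones]
    exact hy

end Involution


/-- the patterns [[0,0,0,0,α_k],[0,0,0,χ,0],[0,0,1,0,0],[0,χᵗ,0,0,0],
[α_k,0,0,0,0]] and [[0,0,0,0,β_k],[0,0,0,χ,0],[0,0,1,0,0],[0,χᵗ,0,0,0],[β_k,0,0,0,0]]
are I-Wilf equivalent. -/
theorem stmt4 {k m : ℕ} (χ : Matrix (Fin m) (Fin m) ℤ) (hχ : IsSignedPermMatrix χ) :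
    ∀ n : ℕ, 1 ≤ n →
      SIAvoidCount n (doublePrimePat (antiBlock2 (1 : Matrix (Fin k) (Fin k) ℤ) χ)) =
      SIAvoidCount n (doublePrimePat (antiBlock2 (betaMat k) χ)) := by
  intro n _
  cases k with
  | zero => rw [Subsingleton.elim (betaMat 0) 1]
  | succ k =>
    choose! f hf using fun (M : Matrix (Fin n) (Fin n) ℤ) (h : IsSignedPermMatrix M ∧ M.IsSymm) =>
      exists_conjInvolution h.1 h.2 χ
    refine Set.ncard_congr (fun M _ => f M) ?_ ?_ ?_
    · rintro M ⟨hM, hs, hav⟩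
      have h := hf M ⟨hM, hs⟩
      exact ⟨h.right, h.right_symm, mt (h.containsPattern_iff hχ k).1 hav⟩
    · rintro M N ⟨hM, hs, -⟩ ⟨hN, hs', -⟩ hMN
      have h := (hf M ⟨hM, hs⟩).symm
      rw [show f M = f N from hMN] at h
      exact h.unique (hf N ⟨hN, hs'⟩).symm
    · rintro M' ⟨hM', hs', hav⟩
      have h := (hf M' ⟨hM', hs'⟩).symm
      exact ⟨f M', ⟨h.left, h.left_symm, mt (h.containsPattern_iff hχ k).2 hav⟩,
        (hf _ ⟨h.left, h.left_symm⟩).unique h⟩
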